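/- arXiv:math/0402382 — 4 statements merged into one kernel-verified Lean document; each statement's English description precedes it below -/
import Mathlib

section
/- Let 0 < α ≤ 1 and let f : ℝ → ℂ be a continuous 1-periodic function whose Fourier coefficients are c_n = ∫₀¹ f(t) e(−nt) dt, and suppose that for every β with 0 < β < α the function f is Hölder continuous of index β. Then for every ε > 0 there exists a constant C > 0 such that for all integers N ≥ 1 and all x ∈ ℝ, |∑_{1 ≤ |n| ≤ N} c_n · n · e(nx)| ≤ C · N^{1+ε−α}. -/
open Complex Filter Finset

/-- `e x = exp(2 π i x)` -/
noncomputable def e (t : ℝ) : ℂ := Complex.exp (2 * Real.pi * Complex.I * t)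

theorem norm_e (t : ℝ) : ‖e t‖ = 1 := by
  rw [e, show 2 * (Real.pi : ℂ) * I * t = ((2 * Real.pi * t : ℝ) : ℂ) * I by push_cast; ring]
  exact Complex.norm_exp_ofReal_mul_I _

theorem e_add (s t : ℝ) : e (s + t) = e s * e t := by
  simp only [e, ← Complex.exp_add]
  congr 1
  push_cast
  ring

theorem e_intCast (n : ℤ) : e n = 1 := by
  rw [e, Complex.exp_eq_one_iff]
  exact ⟨n, by push_cast; ring⟩

theorem continuous_e : Continuous e := by
  unfold e
  fun_prop

theorem hasDerivAt_e_mul (r y : ℝ) :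
    HasDerivAt (fun y : ℝ => e (r * y)) (2 * Real.pi * I * r * e (r * y)) y := by
  have h : HasDerivAt (fun y : ℝ => 2 * (Real.pi : ℂ) * I * ((r * y : ℝ) : ℂ))
      (2 * Real.pi * I * r) y := by
    have := ((hasDerivAt_id y).const_mul r).ofReal_comp.const_mul (2 * (Real.pi : ℂ) * I)
    simpa using this
  have := h.cexp
  simp only [e]
  convert this using 1
  ring

theorem four_mul_abs_le_norm_e_sub_one {u : ℝ} (hu : |u| ≤ 1 / 2) : 4 * |u| ≤ ‖e u - 1‖ := by
  have hπ := Real.pi_pos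
  have h1 : |Real.pi * u| = Real.pi * |u| := by rw [abs_mul, abs_of_pos hπ]
  have h2 := Real.mul_abs_le_abs_sin (x := Real.pi * u) (by rw [h1]; nlinarith)
  rw [h1, ← mul_assoc, div_mul_cancel₀ _ hπ.ne'] at h2
  rw [e, show 2 * (Real.pi : ℂ) * I * u = I * ((2 * (Real.pi * u) : ℝ) : ℂ) by push_cast; ring,
    Complex.norm_exp_I_mul_ofReal_sub_one, Real.norm_eq_abs, abs_mul, abs_two,
    mul_div_cancel_left₀ _ two_ne_zero]
  linarith

/-- Interpolation between the trivial bound `L` and the bound `1 / (2 |u|)` for a geometric sum. -/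
theorem norm_sum_e_le {δ : ℝ} (hδ0 : 0 < δ) (hδ1 : δ ≤ 1) (a : ℤ) (L : ℕ) {u : ℝ} (hu0 : u ≠ 0)
    (hu : |u| ≤ 1 / 2) :
    ‖∑ j ∈ range L, e (((a + j : ℤ) : ℝ) * u)‖ ≤ (L : ℝ) ^ δ * |2 * u| ^ (δ - 1) := by
  set K := ‖∑ j ∈ range L, e (((a + j : ℤ) : ℝ) * u)‖ with hK
  have hK0 : 0 ≤ K := norm_nonneg _
  have hpos : 0 < |u| := abs_pos.mpr hu0
  have hL : K ≤ L := by
    refine (norm_sum_le _ _).trans ?_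
    simp [norm_e]
  have htel : (∑ j ∈ range L, e (((a + j : ℤ) : ℝ) * u)) * (e u - 1)
      = e (((a + L : ℤ) : ℝ) * u) - e ((a : ℝ) * u) := by
    have := Finset.sum_range_sub (fun j : ℕ => e (((a + j : ℤ) : ℝ) * u)) L
    simp only [Nat.cast_zero, add_zero] at this
    rw [← this, Finset.sum_mul]
    refine Finset.sum_congr rfl fun j _ => ?_
    have : ((a + (j + 1 : ℕ) : ℤ) : ℝ) * u = ((a + j : ℤ) : ℝ) * u + u := by push_cast; ring
    rw [this, e_add]
    ring
  have hinv : K ≤ |2 * u|⁻¹ := by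
    have h1 : K * ‖e u - 1‖ ≤ 2 := by
      rw [hK, ← norm_mul, htel]
      refine (norm_sub_le _ _).trans ?_
      rw [norm_e, norm_e]
      norm_num
    have h2 : K * (4 * |u|) ≤ 2 :=
      (mul_le_mul_of_nonneg_left (four_mul_abs_le_norm_e_sub_one hu) hK0).trans h1
    rw [abs_mul, abs_two, ← one_div, le_div_iff₀ (by positivity)]
    linarith
  calc K = K ^ (δ + (1 - δ)) := by simp
    _ = K ^ δ * K ^ (1 - δ) := Real.rpow_add' hK0 (by simp)
    _ ≤ (L : ℝ) ^ δ * (|2 * u|⁻¹) ^ (1 - δ) := by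
        gcongr
    _ = (L : ℝ) ^ δ * |2 * u| ^ (δ - 1) := by
        rw [Real.inv_rpow (abs_nonneg _), ← Real.rpow_neg (abs_nonneg _), neg_sub]

theorem intervalIntegrable_abs_two_mul_rpow {r : ℝ} (hr : -1 < r) :
    IntervalIntegrable (fun u : ℝ => |2 * u| ^ r) MeasureTheory.volume (-(1 / 2)) (1 / 2) := by
  have h1 : IntervalIntegrable (fun u : ℝ => |2 * u| ^ r) MeasureTheory.volume 0 (1 / 2) := by
    refine ((intervalIntegral.intervalIntegrable_rpow' hr).const_mul ((2 : ℝ) ^ r)).congr ?_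
    intro u hu
    rw [Set.uIoc_of_le (by norm_num)] at hu
    simp only [abs_mul, abs_two, abs_of_pos hu.1]
    rw [Real.mul_rpow (by norm_num) hu.1.le]
  have h2 := (IntervalIntegrable.iff_comp_neg).mp h1
  simp only [mul_neg, abs_neg, neg_zero] at h2
  exact h2.symm.trans h1

theorem exists_norm_integral_mul_sum_e_le {δ : ℝ} (hδ0 : 0 < δ) (hδ1 : δ ≤ 1) :
    ∃ C > (0 : ℝ), ∀ (g : ℝ → ℂ) (ω : ℝ), (∀ u, ‖g u‖ ≤ ω) → ∀ (a : ℤ) (L : ℕ),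
      ‖∫ u in (-(1 / 2) : ℝ)..(1 / 2), g u * ∑ j ∈ range L, e (((a + j : ℤ) : ℝ) * u)‖
        ≤ ω * C * (L : ℝ) ^ δ := by
  have hint := intervalIntegrable_abs_two_mul_rpow (r := δ - 1) (by linarith)
  have hnn : 0 ≤ ∫ u in (-(1 / 2) : ℝ)..(1 / 2), |2 * u| ^ (δ - 1) :=
    intervalIntegral.integral_nonneg (by norm_num) fun u _ => by positivity
  refine ⟨(∫ u in (-(1 / 2) : ℝ)..(1 / 2), |2 * u| ^ (δ - 1)) + 1, by linarith,
    fun g ω hg a L => ?_⟩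
  have hω : 0 ≤ ω := (norm_nonneg _).trans (hg 0)
  have hle := intervalIntegral.norm_integral_le_of_norm_le (μ := MeasureTheory.volume)
    (f := fun u => g u * ∑ j ∈ range L, e (((a + j : ℤ) : ℝ) * u))
    (g := fun u => ω * (L : ℝ) ^ δ * |2 * u| ^ (δ - 1))
    (by norm_num : (-(1 / 2) : ℝ) ≤ 1 / 2) ?_ (hint.const_mul _)
  · refine hle.trans ?_
    rw [intervalIntegral.integral_const_mul]
    have : 0 ≤ ω * (L : ℝ) ^ δ := by positivity
    nlinarith
  · filter_upwards [MeasureTheory.Measure.ae_ne MeasureTheory.volume (0 : ℝ)] with u hu0 hu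
    rw [norm_mul, mul_assoc]
    exact mul_le_mul (hg u)
      (norm_sum_e_le hδ0 hδ1 a L hu0 (abs_le.mpr ⟨hu.1.le, hu.2⟩)) (norm_nonneg _) hω

theorem fourierCoeff_mul_e_eq_integral {f : ℝ → ℂ} (hper : Function.Periodic f 1) (n : ℤ)
    (x : ℝ) :
    (∫ t in (0 : ℝ)..1, f t * e (-(n : ℝ) * t)) * e (n * x)
      = ∫ u in (-(1 / 2) : ℝ)..(1 / 2), f (x - u) * e (n * u) := by
  have hp : Function.Periodic (fun s => f s * e (n * (x - s))) 1 := by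
    intro s
    have : (n : ℝ) * (x - (s + 1)) + (n : ℤ) = n * (x - s) := by ring
    have h := e_add ((n : ℝ) * (x - (s + 1))) (n : ℤ)
    rw [this, e_intCast, mul_one] at h
    simp only [hper s, h]
  have h1 := intervalIntegral.integral_comp_sub_left (a := (-(1 / 2) : ℝ)) (b := 1 / 2)
    (fun s => f s * e (n * (x - s))) x
  simp only [sub_sub_cancel] at h1
  have h2 := hp.intervalIntegral_add_eq (x - 1 / 2) 0
  rw [h1, show x - -(1 / 2) = x - 1 / 2 + 1 by ring, h2, zero_add,
    ← intervalIntegral.integral_mul_const]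
  refine intervalIntegral.integral_congr fun s _ => ?_
  rw [mul_assoc, ← e_add]
  ring_nf

theorem exists_norm_sum_translate_sub_le {δ : ℝ} (hδ0 : 0 < δ) (hδ1 : δ ≤ 1) :
    ∃ C > (0 : ℝ), ∀ (f : ℝ → ℂ), Continuous f → Function.Periodic f 1 → ∀ c : ℤ → ℂ,
      (∀ n : ℤ, c n = ∫ t in (0 : ℝ)..1, f t * e (-(n : ℝ) * t)) → ∀ ω t : ℝ,
      (∀ y, ‖f (y + t) - f y‖ ≤ ω) → ∀ (a : ℤ) (L : ℕ) (x : ℝ),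
      ‖∑ j ∈ range L, c (a + j) *
        (e (((a + j : ℤ) : ℝ) * (x + t)) - e (((a + j : ℤ) : ℝ) * x))‖
        ≤ ω * C * (L : ℝ) ^ δ := by
  obtain ⟨C, hC, h⟩ := exists_norm_integral_mul_sum_e_le hδ0 hδ1
  refine ⟨C, hC, fun f hf hper c hc ω t hω a L x => ?_⟩
  have key := h (fun u => f (x - u + t) - f (x - u)) ω (fun u => hω _) a L
  have hce := continuous_e
  convert key using 2
  simp only [Finset.mul_sum]
  rw [intervalIntegral.integral_finsetSum fun j _ =>
    Continuous.intervalIntegrable (by fun_prop) _ _]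
  refine Finset.sum_congr rfl fun j _ => ?_
  rw [mul_sub, hc, fourierCoeff_mul_e_eq_integral hper, fourierCoeff_mul_e_eq_integral hper,
    ← intervalIntegral.integral_sub (Continuous.intervalIntegrable (by fun_prop) _ _)
      (Continuous.intervalIntegrable (by fun_prop) _ _)]
  refine intervalIntegral.integral_congr fun u _ => ?_
  rw [sub_mul, sub_add_eq_add_sub]

theorem norm_sum_natCast_mul_le {z : ℕ → ℂ} {L : ℕ} {B : ℝ}
    (h : ∀ k ≤ L, ‖∑ j ∈ range k, z j‖ ≤ B) :
    ‖∑ j ∈ range L, (j : ℂ) * z j‖ ≤ 2 * L * B := by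
  have parts : ∀ M : ℕ, ∑ j ∈ range M, (j : ℂ) * z j
      = M * ∑ j ∈ range M, z j - ∑ k ∈ range M, ∑ j ∈ range (k + 1), z j := by
    intro M
    induction M with
    | zero => simp
    | succ M ih =>
      rw [Finset.sum_range_succ, ih, Finset.sum_range_succ (fun k => ∑ j ∈ range (k + 1), z j),
        Finset.sum_range_succ z]
      push_cast
      ring
  rw [parts]
  refine (norm_sub_le _ _).trans ?_
  have h1 : ‖(L : ℂ) * ∑ j ∈ range L, z j‖ ≤ L * B := by
    rw [norm_mul, Complex.norm_natCast]
    exact mul_le_mul_of_nonneg_left (h L le_rfl) (Nat.cast_nonneg _)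
  have h2 : ‖∑ k ∈ range L, ∑ j ∈ range (k + 1), z j‖ ≤ L * B := by
    refine (norm_sum_le_of_le _ fun k hk => h (k + 1) (Finset.mem_range.mp hk)).trans ?_
    simp
  linarith

theorem sum_Icc_neg_eq_sum_range (F : ℤ → ℂ) (N : ℕ) :
    ∑ n ∈ Finset.Icc (-(N : ℤ)) N, F n = ∑ j ∈ range (2 * N + 1), F (-(N : ℤ) + j) := by
  symm
  refine Finset.sum_nbij' (fun j : ℕ => -(N : ℤ) + j) (fun n => (n + N).toNat) ?_ ?_ ?_ ?_ ?_
  · intro j hj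
    simp only [Finset.mem_range, Finset.mem_Icc] at *
    omega
  · intro n hn
    simp only [Finset.mem_range, Finset.mem_Icc] at *
    omega
  · intro j _
    simp
  · intro n hn
    simp only [Finset.mem_Icc] at hn
    omega
  · intro j _
    rfl

theorem norm_sum_Icc_mul_intCast_le {w : ℤ → ℂ} {N : ℕ} (hN : 1 ≤ N) {B : ℝ}
    (h : ∀ k ≤ 2 * N + 1, ‖∑ j ∈ range k, w (-(N : ℤ) + j)‖ ≤ B) :
    ‖∑ n ∈ Finset.Icc (-(N : ℤ)) N, (n : ℂ) * w n‖ ≤ 7 * N * B := by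
  have hB : 0 ≤ B := (norm_nonneg _).trans (h 0 (Nat.zero_le _))
  have hN' : (1 : ℝ) ≤ N := by exact_mod_cast hN
  rw [sum_Icc_neg_eq_sum_range]
  have hsplit : ∑ j ∈ range (2 * N + 1), ((-(N : ℤ) + j : ℤ) : ℂ) * w (-(N : ℤ) + j)
      = ∑ j ∈ range (2 * N + 1), (j : ℂ) * w (-(N : ℤ) + j)
        - N * ∑ j ∈ range (2 * N + 1), w (-(N : ℤ) + j) := by
    rw [Finset.mul_sum, ← Finset.sum_sub_distrib]
    refine Finset.sum_congr rfl fun j _ => ?_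
    push_cast
    ring
  rw [hsplit]
  refine (norm_sub_le _ _).trans ?_
  have h1 := norm_sum_natCast_mul_le h
  have h2 : ‖(N : ℂ) * ∑ j ∈ range (2 * N + 1), w (-(N : ℤ) + j)‖ ≤ N * B := by
    rw [norm_mul, Complex.norm_natCast]
    exact mul_le_mul_of_nonneg_left (h _ le_rfl) (Nat.cast_nonneg _)
  push_cast at h1
  nlinarith

/-- The value of a derivative is controlled by one increment of the function and the oscillation
of the derivative. -/
theorem mul_norm_deriv_le {P P' : ℝ → ℂ} (hP : ∀ y, HasDerivAt P (P' y) y) {x h M D : ℝ}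
    (hh : 0 ≤ h) (hM : ‖P (x + h) - P x‖ ≤ M)
    (hD : ∀ t, 0 ≤ t → t ≤ h → ‖P' (x + t) - P' x‖ ≤ D) :
    h * ‖P' x‖ ≤ M + D * h := by
  have hF : ∀ y ∈ Set.Icc x (x + h), HasDerivWithinAt (fun y : ℝ => P y - (y : ℂ) * P' x)
      (P' y - P' x) (Set.Icc x (x + h)) y := by
    intro y _
    have := (hP y).fun_sub ((hasDerivAt_id y).ofReal_comp.mul_const (P' x))
    simpa using this.hasDerivWithinAt
  have hb : ∀ y ∈ Set.Icc x (x + h), ‖P' y - P' x‖ ≤ D := by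
    intro y hy
    have := hD (y - x) (by linarith [hy.1]) (by linarith [hy.2])
    rwa [add_sub_cancel] at this
  have key := (convex_Icc x (x + h)).norm_image_sub_le_of_norm_hasDerivWithin_le hF hb
    (Set.left_mem_Icc.mpr (by linarith)) (Set.right_mem_Icc.mpr (by linarith))
  rw [add_sub_cancel_left, Real.norm_of_nonneg hh] at key
  have hid : (h : ℂ) * P' x = (P (x + h) - P x)
      - (P (x + h) - ((x + h : ℝ) : ℂ) * P' x - (P x - (x : ℂ) * P' x)) := by
    push_cast
    ring
  calc h * ‖P' x‖ = ‖(h : ℂ) * P' x‖ := by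
        rw [norm_mul, Complex.norm_real, Real.norm_of_nonneg hh]
    _ ≤ M + D * h := by
        rw [hid]
        exact (norm_sub_le _ _).trans (add_le_add hM key)

theorem norm_sum_mul_e_le_of_translate {c : ℤ → ℂ} {N : ℕ} (hN : 1 ≤ N) {x M : ℝ}
    (h : ∀ t, 0 ≤ t → t ≤ (N : ℝ)⁻¹ → ∀ k ≤ 2 * N + 1,
      ‖∑ j ∈ range k, c (-(N : ℤ) + j) * (e (((-(N : ℤ) + j : ℤ) : ℝ) * (x + t))
        - e (((-(N : ℤ) + j : ℤ) : ℝ) * x))‖ ≤ M) :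
    ‖∑ n ∈ Finset.Icc (-(N : ℤ)) N, c n * (n : ℂ) * e ((n : ℝ) * x)‖ ≤ 8 * N * M := by
  have hN' : (0 : ℝ) < N := by exact_mod_cast hN
  have hπ : (1 : ℝ) ≤ 2 * Real.pi := by linarith [Real.pi_gt_three]
  have hM0 : 0 ≤ M := by simpa using h 0 le_rfl (by positivity) 0 (Nat.zero_le _)
  set T : ℝ → ℂ := fun y => ∑ n ∈ Finset.Icc (-(N : ℤ)) N, c n * (n : ℂ) * e ((n : ℝ) * y)
    with hT
  have hP : ∀ y, HasDerivAt (fun y : ℝ => ∑ n ∈ Finset.Icc (-(N : ℤ)) N, c n * e ((n : ℝ) * y))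
      (2 * Real.pi * I * T y) y := by
    intro y
    have := HasDerivAt.fun_sum (u := Finset.Icc (-(N : ℤ)) N)
      fun n _ => (hasDerivAt_e_mul (n : ℝ) y).const_mul (c n)
    refine this.congr_deriv ?_
    rw [hT, Finset.mul_sum]
    refine Finset.sum_congr rfl fun n _ => ?_
    push_cast
    ring
  have hn : ∀ w : ℂ, ‖2 * (Real.pi : ℂ) * I * w‖ = 2 * Real.pi * ‖w‖ := by
    intro w
    simp [abs_of_pos Real.pi_pos]
  have key := mul_norm_deriv_le (x := x) (h := (N : ℝ)⁻¹) (M := M)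
    (D := 2 * Real.pi * (7 * N * M)) hP (by positivity) ?_ ?_
  · rw [hn] at key
    have h1 := mul_le_mul_of_nonneg_left key hN'.le
    have h2 : 2 * Real.pi * ‖T x‖ ≤ N * M + 2 * Real.pi * (7 * N * M) := by
      have e1 : (N : ℝ) * ((N : ℝ)⁻¹ * (2 * Real.pi * ‖T x‖)) = 2 * Real.pi * ‖T x‖ := by
        field_simp
      have e2 : (N : ℝ) * (M + 2 * Real.pi * (7 * N * M) * (N : ℝ)⁻¹)
          = N * M + 2 * Real.pi * (7 * N * M) := by
        field_simp
      rwa [e1, e2] at h1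
    have h3 : (N : ℝ) * M ≤ 2 * Real.pi * (N * M) := le_mul_of_one_le_left (by positivity) hπ
    have h4 : 2 * Real.pi * ‖T x‖ ≤ 2 * Real.pi * (8 * N * M) := by linarith
    exact le_of_mul_le_mul_left h4 (by positivity)
  · rw [← Finset.sum_sub_distrib, sum_Icc_neg_eq_sum_range]
    simpa only [mul_sub] using h (N : ℝ)⁻¹ (by positivity) le_rfl (2 * N + 1) le_rfl
  · intro t ht0 ht
    rw [← mul_sub, hn]
    refine mul_le_mul_of_nonneg_left ?_ (by positivity)
    have := norm_sum_Icc_mul_intCast_le hN (h t ht0 ht)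
      (w := fun n => c n * (e ((n : ℝ) * (x + t)) - e ((n : ℝ) * x)))
    refine (congrArg norm ?_).trans_le this
    rw [hT, ← Finset.sum_sub_distrib]
    exact Finset.sum_congr rfl fun n _ => by ring

/-- Theorem 3, implication a) ⇒ c), case k = 1, 0 < α ≤ 1. -/
theorem stmt_0 (α : ℝ) (hα0 : 0 < α) (hα1 : α ≤ 1)
    (f : ℝ → ℂ) (hf : Continuous f) (hper : Function.Periodic f 1)
    (c : ℤ → ℂ)
    (hc : ∀ n : ℤ, c n = ∫ t in (0:ℝ)..1, f t * e (-(n : ℝ) * t))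
    (hHolder : ∀ β : ℝ, 0 < β → β < α → ∃ C > (0:ℝ), ∀ x y : ℝ,
      ‖f x - f y‖ ≤ C * |x - y| ^ β) :
    ∀ ε > (0:ℝ), ∃ C > (0:ℝ), ∀ N : ℕ, 1 ≤ N → ∀ x : ℝ,
      ‖∑ n ∈ Finset.Icc (-(N:ℤ)) (N:ℤ), c n * (n : ℂ) * e ((n : ℝ) * x)‖
        ≤ C * (N : ℝ) ^ (1 + ε - α) := by
  intro ε hε
  obtain ⟨β, hβ0, hβα, hβ⟩ : ∃ β : ℝ, 0 < β ∧ β < α ∧ α - ε / 2 ≤ β :=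
    ⟨max (α / 2) (α - ε / 2), lt_max_of_lt_left (by linarith),
      max_lt (by linarith) (by linarith), le_max_right _ _⟩
  obtain ⟨δ, hδ0, hδ1, hδ⟩ : ∃ δ : ℝ, 0 < δ ∧ δ ≤ 1 ∧ δ ≤ ε / 2 :=
    ⟨min 1 (ε / 2), lt_min one_pos (by linarith), min_le_left _ _, min_le_right _ _⟩
  obtain ⟨A, hA, hfA⟩ := hHolder β hβ0 hβα
  obtain ⟨B, hB, hB'⟩ := exists_norm_sum_translate_sub_le hδ0 hδ1
  refine ⟨8 * (A * B * 3 ^ δ), by positivity, fun N hN x => ?_⟩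
  have hN1 : (1 : ℝ) ≤ N := by exact_mod_cast hN
  have hN0 : (0 : ℝ) < N := by linarith
  refine (norm_sum_mul_e_le_of_translate hN
    (M := A * ((N : ℝ)⁻¹) ^ β * B * (3 * N) ^ δ) ?_).trans ?_
  · intro t ht0 ht k hk
    refine (hB' f hf hper c hc (A * ((N : ℝ)⁻¹) ^ β) t (fun y => ?_) (-(N : ℤ)) k x).trans ?_
    · refine (hfA _ _).trans ?_
      rw [add_sub_cancel_left, abs_of_nonneg ht0]
      gcongr
    · have : (k : ℝ) ≤ 3 * N := by
        have : (k : ℝ) ≤ 2 * N + 1 := by exact_mod_cast hk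
        linarith
      gcongr
  · have hexp : (N : ℝ) * ((N : ℝ)⁻¹ ^ β * (N : ℝ) ^ δ) = (N : ℝ) ^ (1 + (-β + δ)) := by
      rw [Real.rpow_add hN0, Real.rpow_add hN0, Real.rpow_one, Real.inv_rpow hN0.le,
        Real.rpow_neg hN0.le]
    calc 8 * (N : ℝ) * (A * ((N : ℝ)⁻¹) ^ β * B * (3 * N) ^ δ)
        = 8 * (A * B * 3 ^ δ) * ((N : ℝ) * ((N : ℝ)⁻¹ ^ β * (N : ℝ) ^ δ)) := by
          rw [Real.mul_rpow (by norm_num) hN0.le]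
          ring
      _ ≤ 8 * (A * B * 3 ^ δ) * (N : ℝ) ^ (1 + ε - α) := by
          rw [hexp]
          gcongr
          linarith
end

section
/- Let p and q be odd integers with q > 0 and gcd(p, q) = 1. Then the function g : ℝ → ℝ defined by g(x) = ∑_{n=1}^∞ n^{−2} sin(2πn²x) is differentiable at the point x₀ = p/(2q), and g'(x₀) = −π. -/
open Filter

/-- Riemann's nondifferentiable function `g(x) = ∑_{n ≥ 1} n⁻² sin(2πn²x)`.
(The `n = 0` term of the `tsum` vanishes, since `sin 0 = 0`.) -/
noncomputable def g (x : ℝ) : ℝ :=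
  ∑' n : ℕ, Real.sin (2 * Real.pi * (n : ℝ) ^ 2 * x) / (n : ℝ) ^ 2

open Complex in
/-- Uniform bound for the nonconstant part of `jacobiTheta₂ z τ` with `z` real. -/
lemma exists_norm_jacobiTheta₂_sub_one_le :
    ∃ C : ℝ, 0 ≤ C ∧ ∀ z τ : ℂ, z.im = 0 → 0 < τ.im →
      ‖jacobiTheta₂ z τ - 1‖ ≤ C * τ.im ^ (-(3 / 4) : ℝ) := by
  refine ⟨∑' n : ℤ, |(n : ℝ)| ^ (-(3 / 2) : ℝ), tsum_nonneg fun n => by positivity, ?_⟩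
  intro z τ hz hτ
  have hsum := (hasSum_jacobiTheta₂_term z hτ).sub (hasSum_ite_eq (0 : ℤ) (1 : ℂ))
  rw [← hsum.tsum_eq]
  refine tsum_of_norm_bounded
    ((Real.summable_abs_int_rpow (b := 3 / 2) (by norm_num)).hasSum.mul_right _) fun n => ?_
  rcases eq_or_ne n 0 with rfl | hn
  · simp [jacobiTheta₂_term]
  · rw [if_neg hn, sub_zero, norm_jacobiTheta₂_term, hz]
    have hn' : 0 < |(n : ℝ)| := by positivity
    have hx : 0 < |(n : ℝ)| ^ 2 * τ.im := by positivity
    have key : |(n : ℝ)| ^ (-(3 / 2) : ℝ) * τ.im ^ (-(3 / 4) : ℝ)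
        = (|(n : ℝ)| ^ 2 * τ.im) ^ (-(3 / 4) : ℝ) := by
      rw [Real.mul_rpow (by positivity) hτ.le, ← Real.rpow_natCast, ← Real.rpow_mul hn'.le]
      norm_num
    rw [key]
    have h1 : (|(n : ℝ)| ^ 2 * τ.im) ^ (3 / 4 : ℝ) ≤ Real.exp (|(n : ℝ)| ^ 2 * τ.im) := by
      rcases le_total (|(n : ℝ)| ^ 2 * τ.im) 1 with h | h
      · exact (Real.rpow_le_one hx.le h (by norm_num)).trans (Real.one_le_exp hx.le)
      · calc (|(n : ℝ)| ^ 2 * τ.im) ^ (3 / 4 : ℝ) ≤ (|(n : ℝ)| ^ 2 * τ.im) ^ (1 : ℝ) :=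
              Real.rpow_le_rpow_of_exponent_le h (by norm_num)
          _ ≤ _ := by rw [Real.rpow_one]; linarith [Real.add_one_le_exp (|(n : ℝ)| ^ 2 * τ.im)]
    calc Real.exp (-Real.pi * n ^ 2 * τ.im - 2 * Real.pi * n * 0)
        ≤ Real.exp (-(|(n : ℝ)| ^ 2 * τ.im)) := by
          apply Real.exp_le_exp.2
          rw [sq_abs] at *
          nlinarith [Real.pi_gt_three]
      _ = (Real.exp (|(n : ℝ)| ^ 2 * τ.im))⁻¹ := Real.exp_neg _
      _ ≤ ((|(n : ℝ)| ^ 2 * τ.im) ^ (3 / 4 : ℝ))⁻¹ := by gcongr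
      _ = _ := (Real.rpow_neg hx.le _).symm

open Complex in
lemma summable_mul_exp_sq {c : ℤ → ℂ} (hc : ∀ n, ‖c n‖ ≤ 1) {w : ℂ} (hw : 0 < w.im) :
    Summable fun n : ℤ => c n * exp (2 * Real.pi * I * n ^ 2 * w) := by
  have h2 : 0 < (2 * w).im := by simpa using hw
  refine Summable.of_norm_bounded ((summable_jacobiTheta₂_term_iff 0 (2 * w)).2 h2).norm fun n => ?_
  rw [norm_mul]
  refine (mul_le_of_le_one_left (norm_nonneg _) (hc n)).trans_eq ?_
  rw [jacobiTheta₂_term]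
  congr 2
  ring

open Complex in
/-- A theta series with periodic coefficients as a combination of values of `jacobiTheta₂` at the
image of the argument under inversion. -/
lemma tsum_periodic_mul_exp_sq {c : ℤ → ℂ} (hc : ∀ n, ‖c n‖ ≤ 1) {N : ℕ} [NeZero N]
    (hper : Function.Periodic c N) {w : ℂ} (hw : 0 < w.im) :
    ∑' n : ℤ, c n * exp (2 * Real.pi * I * n ^ 2 * w) =
      1 / (-I * (2 * N ^ 2 * w)) ^ (1 / 2 : ℂ) *
        ∑ a : Fin N, c (a : ℕ) * jacobiTheta₂ ((a : ℕ) / N) (-1 / (2 * N ^ 2 * w)) := by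
  have hN : (N : ℂ) ≠ 0 := NeZero.ne _
  have hw0 : w ≠ 0 := by rintro rfl; simp at hw
  have hτ : 0 < (2 * (N : ℂ) ^ 2 * w).im := by
    have : (2 * (N : ℂ) ^ 2 * w) = ((2 * N ^ 2 : ℝ) : ℂ) * w := by push_cast; ring
    rw [this, im_ofReal_mul]
    have : (N : ℝ) ≠ 0 := NeZero.ne _
    positivity
  have hfib (a : Fin N) : HasSum
      (fun m : ℤ => c (m * N + (a : ℕ)) * exp (2 * Real.pi * I * ((m * N + (a : ℕ) : ℤ) : ℂ) ^ 2 * w))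
      (1 / (-I * (2 * N ^ 2 * w)) ^ (1 / 2 : ℂ) *
        (c (a : ℕ) * jacobiTheta₂ ((a : ℕ) / N) (-1 / (2 * N ^ 2 * w)))) := by
    have h := (hasSum_jacobiTheta₂_term (2 * (a : ℕ) * N * w) hτ).mul_left
      (c (a : ℕ) * exp (2 * Real.pi * I * (a : ℕ) ^ 2 * w))
    have hterm (m : ℤ) : c (m * N + (a : ℕ)) *
        exp (2 * Real.pi * I * ((m * N + (a : ℕ) : ℤ) : ℂ) ^ 2 * w) =
        c (a : ℕ) * exp (2 * Real.pi * I * (a : ℕ) ^ 2 * w) *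
          jacobiTheta₂_term m (2 * (a : ℕ) * N * w) (2 * N ^ 2 * w) := by
      have : c (m * N + (a : ℕ)) = c (a : ℕ) := by
        rw [add_comm]; exact hper.int_mul m _
      rw [this, mul_assoc (c _) (exp _), jacobiTheta₂_term, ← exp_add]
      congr 2
      push_cast
      ring
    have hval : 1 / (-I * (2 * N ^ 2 * w)) ^ (1 / 2 : ℂ) *
        (c (a : ℕ) * jacobiTheta₂ ((a : ℕ) / N) (-1 / (2 * N ^ 2 * w))) =
        c (a : ℕ) * exp (2 * Real.pi * I * (a : ℕ) ^ 2 * w) *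
          jacobiTheta₂ (2 * (a : ℕ) * N * w) (2 * N ^ 2 * w) := by
      rw [jacobiTheta₂_functional_equation (2 * (a : ℕ) * N * w)]
      have e1 : 2 * ((a : ℕ) : ℂ) * N * w / (2 * N ^ 2 * w) = (a : ℕ) / N := by
        field_simp
      have e2 : exp (2 * Real.pi * I * (a : ℕ) ^ 2 * w) *
          exp (-Real.pi * I * (2 * (a : ℕ) * N * w) ^ 2 / (2 * N ^ 2 * w)) = 1 := by
        rw [← exp_add, exp_eq_one_iff]
        refine ⟨0, ?_⟩
        field_simp
        ring
      rw [e1]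
      linear_combination (-(c (a : ℕ) * (1 / (-I * (2 * N ^ 2 * w)) ^ (1 / 2 : ℂ)) *
        jacobiTheta₂ ((a : ℕ) / N) (-1 / (2 * N ^ 2 * w)))) * e2
    rw [hval, funext hterm]
    exact h
  have hs := (((Int.divModEquiv N).symm.summable_iff).2 (summable_mul_exp_sq hc hw))
  have hs' := ((Equiv.prodComm (Fin N) ℤ).summable_iff).2 hs
  rw [Finset.mul_sum, ← (Int.divModEquiv N).symm.tsum_eq, ← (Equiv.prodComm (Fin N) ℤ).tsum_eq]
  exact ((hs'.hasSum).prod_fiberwise hfib).unique (hasSum_fintype _)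

open Complex in
/-- A theta series whose periodic coefficients have mean zero is small near `0`. -/
lemma exists_norm_tsum_periodic_mul_exp_sq_le {c : ℤ → ℂ} (hc : ∀ n, ‖c n‖ ≤ 1) {N : ℕ} [NeZero N]
    (hper : Function.Periodic c N) (hmean : ∑ a : Fin N, c (a : ℕ) = 0) :
    ∃ C : ℝ, 0 ≤ C ∧ ∀ w : ℂ, 0 < w.im →
      ‖∑' n : ℤ, c n * exp (2 * Real.pi * I * n ^ 2 * w)‖ ≤ C * ‖w‖ * w.im ^ (-(3 / 4) : ℝ) := by
  obtain ⟨C, hC, hbound⟩ := exists_norm_jacobiTheta₂_sub_one_le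
  have hN : (0 : ℝ) < N := Nat.cast_pos.2 (NeZero.pos N)
  set K : ℝ := 2 * N ^ 2 with hK
  have hK0 : 0 < K := by positivity
  refine ⟨K ^ (-(1 / 2) : ℝ) * (N * (C * K ^ (3 / 4 : ℝ))), by positivity, fun w hw => ?_⟩
  have hw0 : 0 < ‖w‖ := norm_pos_iff.2 (by rintro rfl; simp at hw)
  have hKw : (2 * (N : ℂ) ^ 2 * w) = (K : ℂ) * w := by rw [hK]; push_cast; ring
  have him : (-1 / ((K : ℂ) * w)).im = w.im / (K * ‖w‖ ^ 2) := by
    rw [Complex.sq_norm, neg_div, one_div, neg_im, inv_im, normSq_mul, normSq_ofReal, im_ofReal_mul]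
    field_simp
  have him0 : 0 < (-1 / ((K : ℂ) * w)).im := by rw [him]; positivity
  have hfac : ‖1 / (-I * (K * w)) ^ (1 / 2 : ℂ)‖ = K ^ (-(1 / 2) : ℝ) * ‖w‖ ^ (-(1 / 2) : ℝ) := by
    have : (1 / 2 : ℂ) = ((1 / 2 : ℝ) : ℂ) := by push_cast; rfl
    rw [norm_div, this, norm_cpow_real, ← Real.mul_rpow hK0.le hw0.le, Real.rpow_neg (by positivity)]
    simp [abs_of_pos hK0]
  have hsum : ∑ a : Fin N, c (a : ℕ) * jacobiTheta₂ ((a : ℕ) / N) (-1 / (K * w)) =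
      ∑ a : Fin N, c (a : ℕ) * (jacobiTheta₂ ((a : ℕ) / N) (-1 / (K * w)) - 1) := by
    simp [mul_sub, hmean]
  rw [tsum_periodic_mul_exp_sq hc hper hw, hKw, norm_mul, hfac, hsum]
  have hle : ‖∑ a : Fin N, c (a : ℕ) * (jacobiTheta₂ ((a : ℕ) / N) (-1 / (K * w)) - 1)‖ ≤
      N * (C * (w.im / (K * ‖w‖ ^ 2)) ^ (-(3 / 4) : ℝ)) := by
    refine (norm_sum_le_of_le (n := fun _ => C * (w.im / (K * ‖w‖ ^ 2)) ^ (-(3 / 4) : ℝ))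
      Finset.univ fun a _ => ?_).trans_eq (by simp)
    rw [norm_mul, ← him]
    refine (mul_le_of_le_one_left (norm_nonneg _) (hc _)).trans (hbound _ _ ?_ him0)
    have : (((a : ℕ) : ℂ) / N) = (((a : ℕ) / N : ℝ) : ℂ) := by push_cast; rfl
    rw [this, ofReal_im]
  refine (mul_le_mul_of_nonneg_left hle (by positivity)).trans_eq ?_
  have h1 : (w.im / (K * ‖w‖ ^ 2)) ^ (-(3 / 4) : ℝ) =
      w.im ^ (-(3 / 4) : ℝ) * K ^ (3 / 4 : ℝ) * ‖w‖ ^ (3 / 2 : ℝ) := by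
    rw [Real.div_rpow hw.le (by positivity), Real.mul_rpow hK0.le (by positivity),
      Real.rpow_neg hK0.le, ← Real.rpow_natCast, ← Real.rpow_mul hw0.le,
      show ((2 : ℕ) : ℝ) * -(3 / 4) = -(3 / 2) by norm_num, Real.rpow_neg hw0.le]
    field_simp
  have h2 : ‖w‖ ^ (-(1 / 2) : ℝ) * ‖w‖ ^ (3 / 2 : ℝ) = ‖w‖ := by
    rw [← Real.rpow_add hw0]; norm_num
  rw [h1]
  linear_combination (K ^ (-(1 / 2) : ℝ) * (N * (C * K ^ (3 / 4 : ℝ))) * w.im ^ (-(3 / 4) : ℝ)) * h2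

open Complex in
lemma norm_exp_two_pi_I_sq_le_one (n : ℤ) {w : ℂ} (hw : 0 ≤ w.im) :
    ‖exp (2 * Real.pi * I * n ^ 2 * w)‖ ≤ 1 := by
  rw [norm_exp, Real.exp_le_one_iff]
  have : 2 * Real.pi * I * n ^ 2 * w = ((2 * Real.pi * n ^ 2 : ℝ) : ℂ) * (I * w) := by
    push_cast; ring
  rw [this, re_ofReal_mul, I_mul_re]
  have : 0 ≤ 2 * Real.pi * n ^ 2 * w.im := by have := Real.pi_pos; positivity
  linarith

/-- The antiderivative of `∑ c n e(n² w)`, up to the linear term coming from `n = 0`. -/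
noncomputable def thetaPrimitive (c : ℤ → ℂ) (w : ℂ) : ℂ :=
  ∑' n : ℤ, c n * Complex.exp (2 * Real.pi * Complex.I * n ^ 2 * w) / n ^ 2

lemma summable_one_div_int_sq : Summable fun n : ℤ => 1 / (n : ℝ) ^ 2 :=
  Real.summable_one_div_int_pow.2 one_lt_two

lemma norm_thetaPrimitive_term_le {c : ℤ → ℂ} (hc : ∀ n, ‖c n‖ ≤ 1) (n : ℤ) {w : ℂ}
    (hw : 0 ≤ w.im) :
    ‖c n * Complex.exp (2 * Real.pi * Complex.I * n ^ 2 * w) / n ^ 2‖ ≤ 1 / (n : ℝ) ^ 2 := by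
  rw [norm_div, norm_mul]
  have : ‖((n : ℂ) ^ 2)‖ = (n : ℝ) ^ 2 := by simp
  rw [this]
  gcongr
  exact mul_le_one₀ (hc n) (norm_nonneg _) (norm_exp_two_pi_I_sq_le_one n hw)

lemma summable_thetaPrimitive {c : ℤ → ℂ} (hc : ∀ n, ‖c n‖ ≤ 1) {w : ℂ} (hw : 0 ≤ w.im) :
    Summable fun n : ℤ => c n * Complex.exp (2 * Real.pi * Complex.I * n ^ 2 * w) / n ^ 2 :=
  Summable.of_norm_bounded summable_one_div_int_sq fun n => norm_thetaPrimitive_term_le hc n hw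

lemma continuousOn_thetaPrimitive {c : ℤ → ℂ} (hc : ∀ n, ‖c n‖ ≤ 1) :
    ContinuousOn (thetaPrimitive c) {w | 0 ≤ w.im} :=
  continuousOn_tsum (fun _ => by fun_prop) summable_one_div_int_sq
    fun n _ hw => norm_thetaPrimitive_term_le hc n hw

open Complex in
lemma hasDerivAt_thetaPrimitive {c : ℤ → ℂ} (hc : ∀ n, ‖c n‖ ≤ 1) {w : ℂ} (hw : 0 < w.im) :
    HasDerivAt (thetaPrimitive c)
      (2 * Real.pi * I * (∑' n : ℤ, c n * exp (2 * Real.pi * I * n ^ 2 * w) - c 0)) w := by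
  have hopen : IsOpen {w : ℂ | 0 < w.im} := isOpen_lt continuous_const continuous_im
  have hdiff (n : ℤ) : DifferentiableOn ℂ
      (fun w => c n * exp (2 * Real.pi * I * n ^ 2 * w) / n ^ 2) {w : ℂ | 0 < w.im} := by fun_prop
  have hle (n : ℤ) (v : ℂ) (hv : v ∈ {w : ℂ | 0 < w.im}) :=
    norm_thetaPrimitive_term_le hc n (le_of_lt hv)
  have hd : DifferentiableAt ℂ (thetaPrimitive c) w :=
    (differentiableOn_tsum_of_summable_norm summable_one_div_int_sq hdiff hopen
      hle).differentiableAt (hopen.mem_nhds hw)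
  have hs := hasSum_deriv_of_summable_norm summable_one_div_int_sq hdiff hopen hle hw
  have hs' := ((summable_mul_exp_sq hc hw).hasSum.sub (hasSum_ite_eq (0 : ℤ) (c 0))).mul_left
    (2 * Real.pi * I)
  refine hd.hasDerivAt.congr_deriv (hs.unique (hs'.congr_fun ?_))
  intro n
  have hderiv : HasDerivAt (fun w => c n * exp (2 * Real.pi * I * n ^ 2 * w) / n ^ 2)
      (c n * (exp (2 * Real.pi * I * n ^ 2 * w) * (2 * Real.pi * I * n ^ 2 * 1)) / n ^ 2) w :=
    ((((hasDerivAt_id w).const_mul _).cexp).const_mul _).div_const _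
  rw [hderiv.deriv]
  rcases eq_or_ne n 0 with rfl | hn
  · simp
  · have : (n : ℂ) ≠ 0 := by exact_mod_cast hn
    rw [if_neg hn]
    field_simp
    ring

section BoundaryValues

variable {F F' : ℂ → ℂ} {K r : ℝ}

open Complex in
lemma norm_sub_le_of_vertical (hF : ContinuousOn F {w | 0 ≤ w.im})
    (hF' : ∀ w : ℂ, 0 < w.im → HasDerivAt F (F' w) w) (hr : 0 < r) (x : ℝ)
    (hK : ∀ y : ℝ, 0 < y → y ≤ r → ‖F' (x + y * I)‖ ≤ K * y ^ (-(3 / 4) : ℝ)) :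
    ‖F x - F (x + r * I)‖ ≤ 4 * K * r ^ (1 / 4 : ℝ) := by
  have hline (t : ℝ) : ((x : ℂ) + (r - t : ℝ) * I).im = r - t := by simp
  have hcont : ContinuousOn (fun t : ℝ => F (x + (r - t : ℝ) * I) - F (x + r * I))
      (Set.Icc 0 r) := by
    refine (hF.comp (by fun_prop) fun t ht => ?_).sub continuousOn_const
    simpa using ht.2
  have hder : ∀ t ∈ Set.Ico 0 r, HasDerivWithinAt
      (fun t : ℝ => F (x + (r - t : ℝ) * I) - F (x + r * I))
      (F' (x + (r - t : ℝ) * I) * (((-1 : ℝ) : ℂ) * I)) (Set.Ici t) t := by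
    intro t ht
    have h1 : HasDerivAt (fun t : ℝ => (x : ℂ) + (r - t : ℝ) * I) (((-1 : ℝ) : ℂ) * I) t :=
      ((((hasDerivAt_id t).const_sub r).ofReal_comp).mul_const I).const_add _
    have h2 := hF' (x + (r - t : ℝ) * I) (by rw [hline]; linarith [ht.2])
    exact ((h2.comp t h1).sub_const _).hasDerivWithinAt
  have hB : ContinuousOn (fun t : ℝ => 4 * K * (r ^ (1 / 4 : ℝ) - (r - t) ^ (1 / 4 : ℝ)))
      (Set.Icc 0 r) := by
    refine (Continuous.continuousOn ?_)
    refine continuous_const.mul (continuous_const.sub ?_)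
    exact (continuous_const.sub continuous_id).rpow_const fun _ => Or.inr (by norm_num)
  have hB' : ∀ t ∈ Set.Ico 0 r, HasDerivWithinAt
      (fun t : ℝ => 4 * K * (r ^ (1 / 4 : ℝ) - (r - t) ^ (1 / 4 : ℝ)))
      (K * (r - t) ^ (-(3 / 4) : ℝ)) (Set.Ici t) t := by
    intro t ht
    have h1 := (((((hasDerivAt_id t).const_sub r).rpow_const (p := 1 / 4)
      (Or.inl (sub_pos.2 ht.2).ne')).const_sub (r ^ (1 / 4 : ℝ))).const_mul (4 * K))
    refine (h1.congr_deriv ?_).hasDerivWithinAt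
    norm_num
    ring
  have := image_norm_le_of_norm_deriv_right_le_deriv_boundary' hcont hder (by simp) hB hB'
    (fun t ht => ?_) (Set.right_mem_Icc.2 hr.le)
  · simpa using this
  · have h := hK (r - t) (by linarith [ht.2]) (by linarith [ht.1])
    simpa using h

open Complex in
/-- A holomorphic function on the upper half plane whose derivative is `O(|w| (Im w)^(-3/4))`
has boundary values that vary by `O(|x|^(5/4))` near `0`. -/
lemma norm_boundary_sub_le (hF : ContinuousOn F {w | 0 ≤ w.im})
    (hF' : ∀ w : ℂ, 0 < w.im → HasDerivAt F (F' w) w) (hK0 : 0 ≤ K)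
    (hK : ∀ w : ℂ, 0 < w.im → ‖F' w‖ ≤ K * ‖w‖ * w.im ^ (-(3 / 4) : ℝ)) (x : ℝ) :
    ‖F x - F 0‖ ≤ 18 * K * |x| ^ (5 / 4 : ℝ) := by
  rcases eq_or_ne x 0 with rfl | hx
  · simp
  have hr : 0 < |x| := abs_pos.2 hx
  set r := |x| with hrdef
  have hnorm (s y : ℝ) (hs : |s| ≤ r) (hy : 0 < y) (hyr : y ≤ r) : ‖(s + y * I : ℂ)‖ ≤ 2 * r := by
    refine (norm_add_le _ _).trans ?_
    simp only [norm_real, norm_mul, norm_I, mul_one, Real.norm_eq_abs, abs_of_pos hy]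
    linarith
  have hder (s y : ℝ) (hs : |s| ≤ r) (hy : 0 < y) (hyr : y ≤ r) :
      ‖F' (s + y * I)‖ ≤ K * (2 * r) * y ^ (-(3 / 4) : ℝ) := by
    have him : (s + y * I : ℂ).im = y := by simp
    refine (hK _ (by rw [him]; exact hy)).trans ?_
    rw [him]
    gcongr
    exact hnorm s y hs hy hyr
  have hvert (s : ℝ) (hs : |s| ≤ r) := norm_sub_le_of_vertical hF hF' hr s
    fun y hy hyr => hder s y hs hy hyr
  have h0 := hvert 0 (by simpa using hr.le)
  have hx' := hvert x le_rfl
  have hhor : ‖F (x + r * I) - F ((0 : ℝ) + r * I)‖ ≤ K * (2 * r) * r ^ (-(3 / 4) : ℝ) * ‖x - 0‖ := by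
    refine Convex.norm_image_sub_le_of_norm_hasDerivWithin_le (s := Set.Icc (-r) r)
      (f := fun s : ℝ => F (s + r * I)) (f' := fun s : ℝ => F' (s + r * I) * 1)
      (fun s _ => ?_) (fun s hs => ?_) (convex_Icc _ _) ⟨by linarith, hr.le⟩
      (abs_le.1 le_rfl)
    · have h1 : HasDerivAt (fun s : ℝ => (s : ℂ) + r * I) 1 s :=
        ((hasDerivAt_id s).ofReal_comp).add_const _
      exact ((hF' (s + r * I) (by simpa using hr)).comp s h1).hasDerivWithinAt
    · rw [mul_one]
      exact hder s r (abs_le.2 hs) hr le_rfl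
  rw [sub_zero, Real.norm_eq_abs, ← hrdef] at hhor
  have e1 : r ^ (5 / 4 : ℝ) = r * r ^ (1 / 4 : ℝ) := by
    rw [← Real.rpow_one_add' hr.le (by norm_num)]; norm_num
  have e2 : r ^ (-(3 / 4) : ℝ) * r = r ^ (1 / 4 : ℝ) := by
    rw [← Real.rpow_add_one hr.ne']; norm_num
  have hhor' : ‖F (x + r * I) - F ((0 : ℝ) + r * I)‖ ≤ 2 * K * r ^ (5 / 4 : ℝ) := by
    refine hhor.trans_eq ?_
    rw [e1, ← e2]
    ring
  have hsplit : F x - F 0 = (F x - F (x + r * I)) + (F (x + r * I) - F ((0 : ℝ) + r * I))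
      - (F (0 : ℝ) - F ((0 : ℝ) + r * I)) := by
    push_cast
    ring
  rw [hsplit]
  refine (norm_sub_le _ _).trans ((add_le_add (norm_add_le _ _) le_rfl).trans ?_)
  rw [e1] at *
  linarith

end BoundaryValues

open Complex in
lemma im_thetaPrimitive_eq (x₀ h : ℝ) :
    (thetaPrimitive (fun n => exp (2 * Real.pi * I * n ^ 2 * x₀)) h).im = 2 * g (x₀ + h) := by
  have hc (n : ℤ) := norm_exp_two_pi_I_sq_le_one n (w := x₀) (by simp)
  have hs := hasSum_im (summable_thetaPrimitive hc (w := h) (by simp)).hasSum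
  have hterm (n : ℤ) : (exp (2 * Real.pi * I * n ^ 2 * x₀) * exp (2 * Real.pi * I * n ^ 2 * h) /
      n ^ 2).im = Real.sin (2 * Real.pi * (n : ℝ) ^ 2 * (x₀ + h)) / (n : ℝ) ^ 2 := by
    rw [← exp_add, show 2 * Real.pi * I * n ^ 2 * x₀ + 2 * Real.pi * I * n ^ 2 * h =
      ((2 * Real.pi * (n : ℝ) ^ 2 * (x₀ + h) : ℝ) : ℂ) * I by push_cast; ring,
      show ((n : ℂ) ^ 2) = (((n : ℝ) ^ 2 : ℝ) : ℂ) by push_cast; rfl, div_ofReal_im,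
      exp_ofReal_mul_I_im]
  simp only [hterm] at hs
  have hn := hs.nat_add_neg.tsum_eq
  rw [thetaPrimitive]
  simp only [Int.cast_neg, even_two, Even.neg_pow, Int.cast_natCast, Int.cast_zero,
    ← two_mul, tsum_mul_left] at hn
  rw [g, hn]
  simp

open Complex in
/-- If the coefficients `e(n² x₀)` are periodic with mean zero, then `g` has derivative `-π` at
`x₀`. -/
lemma hasDerivAt_g_of_mean_zero {x₀ : ℝ} {N : ℕ} [NeZero N]
    (hper : Function.Periodic (fun n : ℤ => exp (2 * Real.pi * I * n ^ 2 * x₀)) N)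
    (hmean : ∑ a : Fin N, exp (2 * Real.pi * I * (((a : ℕ) : ℤ) : ℂ) ^ 2 * x₀) = 0) :
    HasDerivAt g (-Real.pi) x₀ := by
  set c : ℤ → ℂ := fun n => exp (2 * Real.pi * I * n ^ 2 * x₀) with hcdef
  have hc (n : ℤ) : ‖c n‖ ≤ 1 := norm_exp_two_pi_I_sq_le_one n (by simp)
  have hc0 : c 0 = 1 := by simp [hcdef]
  obtain ⟨C, hC, hbound⟩ := exists_norm_tsum_periodic_mul_exp_sq_le hc hper hmean
  have hcont : ContinuousOn (fun w => thetaPrimitive c w + 2 * Real.pi * I * w) {w | 0 ≤ w.im} :=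
    (continuousOn_thetaPrimitive hc).add (by fun_prop)
  have hder (w : ℂ) (hw : 0 < w.im) :
      HasDerivAt (fun w => thetaPrimitive c w + 2 * Real.pi * I * w)
        (2 * Real.pi * I * ∑' n : ℤ, c n * exp (2 * Real.pi * I * n ^ 2 * w)) w := by
    refine ((hasDerivAt_thetaPrimitive hc hw).add
      ((hasDerivAt_id w).const_mul (2 * Real.pi * I))).congr_deriv ?_
    rw [hc0]
    ring
  have hle := norm_boundary_sub_le (K := 2 * Real.pi * C) hcont hder (by positivity) fun w hw => by
    rw [norm_mul]
    have : ‖(2 * Real.pi * I : ℂ)‖ = 2 * Real.pi := by simp [abs_of_pos Real.pi_pos]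
    rw [this, mul_assoc (2 * Real.pi), mul_assoc (2 * Real.pi)]
    exact mul_le_mul_of_nonneg_left (hbound w hw) (by positivity)
  rw [hasDerivAt_iff_isLittleO_nhds_zero]
  have hO : (fun h : ℝ => g (x₀ + h) - g x₀ - h • -Real.pi) =O[nhds 0]
      fun h : ℝ => |h| ^ (5 / 4 : ℝ) := by
    refine Asymptotics.IsBigO.of_bound (18 * (2 * Real.pi * C)) (Eventually.of_forall fun h => ?_)
    have h0 := im_thetaPrimitive_eq x₀ 0
    have hh := im_thetaPrimitive_eq x₀ h
    rw [← hcdef] at h0 hh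
    rw [add_zero, ofReal_zero] at h0
    have him : (thetaPrimitive c h + 2 * Real.pi * I * h
        - (thetaPrimitive c 0 + 2 * Real.pi * I * 0)).im =
        2 * (g (x₀ + h) - g x₀ - h • -Real.pi) := by
      have : (2 * Real.pi * I * h : ℂ).im = 2 * Real.pi * h := by
        simp
      rw [sub_im, add_im, add_im, hh, h0, this]
      simp
      ring
    have h1 := (abs_im_le_norm _).trans (hle h)
    rw [him, abs_mul, abs_two] at h1
    rw [Real.norm_eq_abs, Real.norm_of_nonneg (by positivity)]
    linarith [abs_nonneg (g (x₀ + h) - g x₀ - h • -Real.pi)]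
  refine hO.trans_isLittleO ?_
  have hlim : Tendsto (fun h : ℝ => |h| ^ (1 / 4 : ℝ)) (nhds 0) (nhds 0) := by
    have : Continuous fun h : ℝ => |h| ^ (1 / 4 : ℝ) :=
      continuous_abs.rpow_const fun _ => Or.inr (by norm_num)
    simpa using this.tendsto 0
  have hmul : (fun h : ℝ => |h| ^ (1 / 4 : ℝ) * |h|) =o[nhds 0] fun h : ℝ => 1 * |h| :=
    ((Asymptotics.isLittleO_one_iff ℝ).2 hlim).mul_isBigO (Asymptotics.isBigO_refl _ _)
  simp only [one_mul] at hmul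
  refine (Asymptotics.isLittleO_abs_right.1 hmul).congr_left fun h => ?_
  rw [← Real.rpow_add_one' (abs_nonneg h) (by norm_num)]
  norm_num

open Complex in
/-- The quadratic phases at `p / (2q)` change sign under translation by `q`. -/
lemma exp_sq_div_antiperiodic {p q : ℤ} (hp : Odd p) (hq : Odd q) :
    Function.Antiperiodic
      (fun n : ℤ => exp (2 * Real.pi * I * n ^ 2 * ((p / (2 * q) : ℝ) : ℂ))) q := by
  intro n
  have hq0 : (q : ℂ) ≠ 0 := by
    have : q ≠ 0 := by rintro rfl; simp at hq
    exact_mod_cast this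
  obtain ⟨k, hk⟩ := hp.mul hq
  have hk' : (p : ℂ) * q = 2 * k + 1 := by exact_mod_cast hk
  have : 2 * Real.pi * I * ((n + q : ℤ) : ℂ) ^ 2 * ((p / (2 * q) : ℝ) : ℂ) =
      2 * Real.pi * I * n ^ 2 * ((p / (2 * q) : ℝ) : ℂ) + Real.pi * I +
        ((n * p + k : ℤ) : ℂ) * (2 * Real.pi * I) := by
    push_cast
    field_simp
    linear_combination (q : ℂ) * hk'
  simp only [this]
  rw [exp_add, exp_int_mul_two_pi_mul_I, exp_add, exp_pi_mul_I]
  ring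

/-- At rationals `p/(2q)` with `p, q` odd and coprime, Riemann's function is
differentiable with derivative `-π`. -/
theorem stmt_9 (p q : ℤ) (hp : Odd p) (hq : Odd q) (hq0 : 0 < q)
    (hpq : Int.gcd p q = 1) :
    HasDerivAt g (-Real.pi) ((p : ℝ) / (2 * (q : ℝ))) := by
  have hanti := exp_sq_div_antiperiodic hp hq
  lift q to ℕ using hq0.le
  have : NeZero (2 * q) := ⟨by omega⟩
  refine hasDerivAt_g_of_mean_zero (N := 2 * q) ?_ ?_
  · simpa using hanti.periodic_two_mul
  · rw [Fin.sum_univ_eq_sum_range (fun a : ℕ => Complex.exp (2 * Real.pi * Complex.I *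
      ((a : ℤ) : ℂ) ^ 2 * ((p / (2 * (q : ℤ)) : ℝ) : ℂ))), two_mul, Finset.sum_range_add,
      ← Finset.sum_add_distrib]
    refine Finset.sum_eq_zero fun a _ => ?_
    have := hanti a
    simp only at this
    rw [show ((q + a : ℕ) : ℤ) = a + q by push_cast; ring, this, add_neg_cancel]
end

section
/- Let r be a rational number which, when written in lowest terms r = a/b with b > 0, satisfies b mod 4 ≠ 2 (equivalently, r cannot be written as p/(2q) with p and q both odd). Then the function g : ℝ → ℝ defined by g(x) = ∑_{n=1}^∞ n^{−2} sin(2πn²x) is not differentiable at r. -/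
open Filter

section

open MeasureTheory FourierTransform SchwartzMap

/-- Integrating `sin` against the Fourier transform of a Schwartz function supported on the
positive half-line picks out a single exponential. -/
theorem integral_sin_mul_fourier (Ψ : 𝓢(ℝ, ℂ)) (hΨ : ∀ ξ ≤ 0, Ψ ξ = 0) (θ w : ℝ) (hw : 0 ≤ w) :
    ∫ x : ℝ, (Real.sin (θ + 2 * Real.pi * w * x) : ℂ) * (𝓕 Ψ : 𝓢(ℝ, ℂ)) x =
      Complex.exp (θ * Complex.I) / (2 * Complex.I) * Ψ w := by
  have inv (v : ℝ) : ∫ x : ℝ, Complex.exp ((2 * Real.pi * (v * x) : ℝ) * Complex.I) *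
      (𝓕 Ψ : 𝓢(ℝ, ℂ)) x = Ψ v := by
    have h : (𝓕⁻ (𝓕 Ψ : 𝓢(ℝ, ℂ)) : 𝓢(ℝ, ℂ)) v = Ψ v := by
      rw [FourierTransform.fourierInv_fourier_eq]
    rw [← h, SchwartzMap.fourierInv_coe, Real.fourierInv_eq']
    simp [mul_comm]
  have hexp (w : ℝ) : Integrable fun x : ℝ ↦
      Complex.exp ((2 * Real.pi * (w * x) : ℝ) * Complex.I) * (𝓕 Ψ : 𝓢(ℝ, ℂ)) x := by
    refine (𝓕 Ψ : 𝓢(ℝ, ℂ)).integrable.bdd_mul (c := 1) (by fun_prop) ?_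
    exact Eventually.of_forall fun x ↦ (Complex.norm_exp_ofReal_mul_I _).le
  have hsplit (x : ℝ) : (Real.sin (θ + 2 * Real.pi * w * x) : ℂ) * (𝓕 Ψ : 𝓢(ℝ, ℂ)) x =
      Complex.exp (θ * Complex.I) / (2 * Complex.I) *
        (Complex.exp ((2 * Real.pi * (w * x) : ℝ) * Complex.I) * (𝓕 Ψ : 𝓢(ℝ, ℂ)) x) -
      Complex.exp (-θ * Complex.I) / (2 * Complex.I) *
        (Complex.exp ((2 * Real.pi * (-w * x) : ℝ) * Complex.I) * (𝓕 Ψ : 𝓢(ℝ, ℂ)) x) := by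
    have e1 : Complex.exp (θ * Complex.I) * Complex.exp ((2 * Real.pi * (w * x) : ℝ) * Complex.I) =
        Complex.exp ((θ + 2 * Real.pi * w * x) * Complex.I) := by
      rw [← Complex.exp_add]; congr 1; push_cast; ring
    have e2 : Complex.exp (-θ * Complex.I) * Complex.exp ((2 * Real.pi * (-w * x) : ℝ) * Complex.I) =
        Complex.exp (-(θ + 2 * Real.pi * w * x) * Complex.I) := by
      rw [← Complex.exp_add]; congr 1; push_cast; ring
    have e3 : (Real.sin (θ + 2 * Real.pi * w * x) : ℂ) =
        (Complex.exp (θ * Complex.I) * Complex.exp ((2 * Real.pi * (w * x) : ℝ) * Complex.I) -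
        Complex.exp (-θ * Complex.I) * Complex.exp ((2 * Real.pi * (-w * x) : ℝ) * Complex.I)) /
          (2 * Complex.I) := by
      rw [e1, e2, Complex.ofReal_sin, Complex.sin]
      push_cast
      field_simp
      rw [Complex.I_sq]
      ring
    rw [e3]
    ring
  simp_rw [hsplit]
  rw [integral_sub ((hexp _).const_mul _) ((hexp _).const_mul _), integral_const_mul,
    integral_const_mul, inv, inv, hΨ (-w) (by linarith)]
  simp

theorem abs_g_le (x : ℝ) : |g x| ≤ ∑' n : ℕ, 1 / (n : ℝ) ^ 2 := by
  refine tsum_of_norm_bounded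
    (f := fun n : ℕ ↦ Real.sin (2 * Real.pi * (n : ℝ) ^ 2 * x) / (n : ℝ) ^ 2)
    (Real.summable_one_div_nat_pow.2 one_lt_two).hasSum fun n ↦ ?_
  rw [norm_div, norm_pow, Real.norm_natCast]
  gcongr
  exact Real.abs_sin_le_one _

theorem continuous_g : Continuous g := by
  refine continuous_tsum (fun n ↦ by fun_prop) (Real.summable_one_div_nat_pow.2 one_lt_two)
    fun n x ↦ ?_
  rw [norm_div, norm_pow, Real.norm_natCast]
  gcongr
  exact Real.abs_sin_le_one _

/-- A bounded function that is differentiable at a point satisfies a global Lipschitz bound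
centred at that point. -/
theorem DifferentiableAt.exists_abs_sub_le_mul {f : ℝ → ℝ} {r M : ℝ}
    (hf : DifferentiableAt ℝ f r) (hM : ∀ x, |f x| ≤ M) :
    ∃ C, 0 ≤ C ∧ ∀ x, |f (r + x) - f r| ≤ C * |x| := by
  obtain ⟨K, hK⟩ := hf.isBigO_sub.bound
  obtain ⟨ε, hε, h⟩ := Metric.eventually_nhds_iff.1 hK
  have hM0 : 0 ≤ M := (abs_nonneg _).trans (hM 0)
  refine ⟨max K (2 * M / ε), le_max_of_le_right (by positivity), fun x ↦ ?_⟩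
  rcases lt_or_ge |x| ε with hx | hx
  · have := h (y := r + x) (by simpa [Real.dist_eq] using hx)
    simp only [add_sub_cancel_left, Real.norm_eq_abs] at this
    exact this.trans (by gcongr; exact le_max_left _ _)
  · calc |f (r + x) - f r| ≤ |f (r + x)| + |f r| := abs_sub _ _
      _ ≤ 2 * M / ε * ε := by
        rw [div_mul_cancel₀ _ hε.ne']
        linarith [hM (r + x), hM r]
      _ ≤ _ := by gcongr; exact le_max_right _ _

/-- The exponential sums obtained by testing `g` near `r` against a dilated kernel. -/
theorem integral_g_mul_fourier (Ψ : 𝓢(ℝ, ℂ)) (hΨ : ∀ ξ ≤ 0, Ψ ξ = 0) (r δ : ℝ) (hδ : 0 ≤ δ) :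
    ∫ x : ℝ, (g (r + δ * x) : ℂ) * (𝓕 Ψ : 𝓢(ℝ, ℂ)) x =
      (∑' n : ℕ, Complex.exp ((2 * Real.pi * (n : ℝ) ^ 2 * r : ℝ) * Complex.I) *
        (Ψ ((n : ℝ) ^ 2 * δ) / (n : ℂ) ^ 2)) / (2 * Complex.I) := by
  set ψ : 𝓢(ℝ, ℂ) := 𝓕 Ψ
  let F (n : ℕ) (x : ℝ) : ℂ :=
    ((Real.sin (2 * Real.pi * (n : ℝ) ^ 2 * (r + δ * x)) / (n : ℝ) ^ 2 : ℝ) : ℂ) * ψ x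
  have hbound (n : ℕ) (x : ℝ) : ‖F n x‖ ≤ 1 / (n : ℝ) ^ 2 * ‖ψ x‖ := by
    rw [norm_mul, Complex.norm_real, norm_div, norm_pow, Real.norm_natCast]
    gcongr
    exact Real.abs_sin_le_one _
  have hF (n : ℕ) : Integrable (F n) := by
    refine (ψ.integrable.norm.const_mul (1 / (n : ℝ) ^ 2)).mono' ?_
      (Eventually.of_forall (hbound n))
    exact Continuous.aestronglyMeasurable (by fun_prop)
  have hsum : Summable fun n ↦ ∫ x, ‖F n x‖ := by
    refine .of_nonneg_of_le (fun n ↦ integral_nonneg fun x ↦ norm_nonneg _) (fun n ↦ ?_)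
      ((Real.summable_one_div_nat_pow.2 one_lt_two).mul_right (∫ x, ‖ψ x‖))
    rw [← integral_const_mul]
    exact integral_mono (hF n).norm (ψ.integrable.norm.const_mul _) (hbound n)
  have hgF (x : ℝ) : (g (r + δ * x) : ℂ) * ψ x = ∑' n, F n x := by
    rw [tsum_mul_right, g, Complex.ofReal_tsum]
  simp_rw [hgF]
  rw [← integral_tsum_of_summable_integral_norm hF hsum, ← tsum_div_const]
  congr 1 with n
  have := integral_sin_mul_fourier Ψ hΨ (2 * Real.pi * (n : ℝ) ^ 2 * r) ((n : ℝ) ^ 2 * δ)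
    (by positivity)
  calc ∫ x, F n x = ∫ x, ((n : ℂ) ^ 2)⁻¹ * ((Real.sin (2 * Real.pi * (n : ℝ) ^ 2 * r +
        2 * Real.pi * ((n : ℝ) ^ 2 * δ) * x) : ℂ) * ψ x) := by
        congr 1 with x
        simp only [F]
        rw [show 2 * Real.pi * (n : ℝ) ^ 2 * (r + δ * x) = 2 * Real.pi * (n : ℝ) ^ 2 * r +
          2 * Real.pi * ((n : ℝ) ^ 2 * δ) * x by ring]
        push_cast
        ring
    _ = _ := by
        rw [integral_const_mul, this]
        ring

/-- Differentiability of `g` at `r` bounds the smoothed exponential sums `∑ n⁻² e(n² r) Ψ(n² δ)`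
linearly in `δ`. -/
theorem exists_norm_tsum_le_of_differentiableAt (Ψ : 𝓢(ℝ, ℂ)) (hΨ : ∀ ξ ≤ 0, Ψ ξ = 0) {r : ℝ}
    (hg : DifferentiableAt ℝ g r) :
    ∃ C, ∀ δ, 0 ≤ δ →
      ‖∑' n : ℕ, Complex.exp ((2 * Real.pi * (n : ℝ) ^ 2 * r : ℝ) * Complex.I) *
        (Ψ ((n : ℝ) ^ 2 * δ) / (n : ℂ) ^ 2)‖ ≤ C * δ := by
  obtain ⟨C, hC0, hC⟩ := hg.exists_abs_sub_le_mul abs_g_le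
  refine ⟨2 * (C * ∫ x, ‖x‖ ^ 1 * ‖(𝓕 Ψ : 𝓢(ℝ, ℂ)) x‖), fun δ hδ ↦ ?_⟩
  have key := integral_g_mul_fourier Ψ hΨ r δ hδ
  have h0 := integral_g_mul_fourier Ψ hΨ r 0 le_rfl
  set ψ : 𝓢(ℝ, ℂ) := 𝓕 Ψ
  have hgi (δ : ℝ) : Integrable fun x ↦ (g (r + δ * x) : ℂ) * ψ x := by
    refine ψ.integrable.bdd_mul (c := ∑' n : ℕ, 1 / (n : ℝ) ^ 2) ?_
      (Eventually.of_forall fun x ↦ ?_)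
    · have := continuous_g
      exact Continuous.aestronglyMeasurable (by fun_prop)
    · rw [Complex.norm_real]
      exact abs_g_le _
  have h0' : ∫ x, (g (r + 0 * x) : ℂ) * ψ x = 0 := by
    rw [h0]; simp [hΨ 0 le_rfl]
  have hbd : ‖∫ x, (g (r + δ * x) : ℂ) * ψ x‖ ≤ C * δ * ∫ x, ‖x‖ ^ 1 * ‖ψ x‖ := by
    rw [← sub_zero (∫ x, (g (r + δ * x) : ℂ) * ψ x), ← h0', ← integral_sub (hgi δ) (hgi 0),
      ← integral_const_mul]
    refine norm_integral_le_of_norm_le ((ψ.integrable_pow_mul volume 1).const_mul _)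
      (Eventually.of_forall fun x ↦ ?_)
    rw [← sub_mul, norm_mul, ← Complex.ofReal_sub, Complex.norm_real, pow_one, zero_mul, add_zero,
      ← mul_assoc]
    gcongr
    have := hC (δ * x)
    rwa [abs_mul, abs_of_nonneg hδ, ← mul_assoc] at this
  rw [key, norm_div, norm_mul, Complex.norm_I, Complex.norm_ofNat, mul_one,
    div_le_iff₀ two_pos] at hbd
  linarith

/-- Lower bound for Riemann sums with periodic coefficients. -/
theorem le_norm_sum_periodic_mul {b : ℕ} (hb : 0 < b) {c : ℕ → ℂ}
    (hper : ∀ m j, c (b * m + j) = c j)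
    (hc : ∀ n, ‖c n‖ ≤ 1) {f : ℝ → ℝ} {L : NNReal} (hf : LipschitzWith L f) (hf0 : ∀ x, 0 ≤ f x)
    (hf1 : ∀ x, 1 ≤ x → x ≤ 2 → f x = 1) {N : ℕ} (hN : 0 < N) :
    N * ‖∑ j ∈ Finset.range b, c j‖ - 3 * b * L ≤
      ‖∑ n ∈ Finset.range (b * (3 * N)), c n * f (n / (b * N))‖ := by
  have hb' : (0 : ℝ) < b := by exact_mod_cast hb
  have hN' : (0 : ℝ) < N := by exact_mod_cast hN
  have hsum : ∑ n ∈ Finset.range (b * (3 * N)), c n * f (n / (b * N)) =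
      ∑ m ∈ Finset.range (3 * N), ∑ j ∈ Finset.range b,
        c j * f (((b * m + j : ℕ) : ℝ) / (b * N)) := by
    induction 3 * N with
    | zero => simp
    | succ k ih =>
      rw [mul_add, mul_one, Finset.sum_range_add, ih, Finset.sum_range_succ]
      simp_rw [hper]
  have hmain : (∑ m ∈ Finset.range (3 * N), f (m / N) : ℝ) * ‖∑ j ∈ Finset.range b, c j‖ =
      ‖∑ m ∈ Finset.range (3 * N), ∑ j ∈ Finset.range b, c j * f ((m : ℝ) / N)‖ := by
    simp_rw [← Finset.sum_mul, ← Finset.mul_sum, ← Complex.ofReal_sum]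
    rw [norm_mul, Complex.norm_real, Real.norm_of_nonneg (Finset.sum_nonneg fun _ _ ↦ hf0 _),
      mul_comm]
  have hlow : (N : ℝ) ≤ ∑ m ∈ Finset.range (3 * N), f (m / N) := by
    calc (N : ℝ) = ∑ m ∈ Finset.Ico N (2 * N), f (m / N) := by
          rw [Finset.sum_congr rfl fun m hm ↦ ?_, Finset.sum_const (1 : ℝ)]
          · simp [two_mul]
          · rw [Finset.mem_Ico] at hm
            refine hf1 _ ?_ ?_
            · rw [one_le_div hN']; exact_mod_cast hm.1
            · rw [div_le_iff₀ hN']; exact_mod_cast hm.2.le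
      _ ≤ _ := Finset.sum_le_sum_of_subset_of_nonneg
          (fun m hm ↦ by simp only [Finset.mem_Ico, Finset.mem_range] at *; omega)
          fun _ _ _ ↦ hf0 _
  have herr : ‖∑ m ∈ Finset.range (3 * N), ∑ j ∈ Finset.range b, c j * f ((m : ℝ) / N) -
      ∑ m ∈ Finset.range (3 * N), ∑ j ∈ Finset.range b,
        c j * f (((b * m + j : ℕ) : ℝ) / (b * N))‖ ≤ 3 * b * L := by
    simp_rw [← Finset.sum_sub_distrib, ← mul_sub]
    calc _ ≤ ∑ m ∈ Finset.range (3 * N), ∑ j ∈ Finset.range b, (L / N : ℝ) := by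
          refine norm_sum_le_of_le _ fun m _ ↦ norm_sum_le_of_le _ fun j hj ↦ ?_
          rw [norm_mul, ← Complex.ofReal_sub, Complex.norm_real]
          have hj' : (j : ℝ) ≤ b := by exact_mod_cast (Finset.mem_range.1 hj).le
          have hd : |(m : ℝ) / N - ((b * m + j : ℕ) : ℝ) / (b * N)| ≤ 1 / N := by
            have : (m : ℝ) / N - ((b * m + j : ℕ) : ℝ) / (b * N) = -(j / b / N) := by
              push_cast; field_simp; ring
            rw [this, abs_neg, abs_of_nonneg (by positivity)]
            gcongr
            exact (div_le_one hb').2 hj'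
          calc _ ≤ 1 * (L * |(m : ℝ) / N - ((b * m + j : ℕ) : ℝ) / (b * N)|) := by
                gcongr
                · exact hc j
                · exact hf.norm_sub_le _ _
            _ ≤ 1 * (L * (1 / N)) := by gcongr
            _ = _ := by ring
      _ = _ := by
          simp only [Finset.sum_const, Finset.card_range, nsmul_eq_mul]
          push_cast
          field_simp
  rw [hsum]
  have := norm_sub_norm_le (∑ m ∈ Finset.range (3 * N), ∑ j ∈ Finset.range b,
    c j * (f ((m : ℝ) / N) : ℂ)) (∑ m ∈ Finset.range (3 * N), ∑ j ∈ Finset.range b,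
        c j * (f (((b * m + j : ℕ) : ℝ) / (b * N)) : ℂ))
  rw [← hmain] at this
  have := mul_le_mul_of_nonneg_right hlow (norm_nonneg (∑ j ∈ Finset.range b, c j))
  linarith

/-- If periodic, the phase `n ↦ e(n² r)` has vanishing sum over a period as soon as `g` is
differentiable at `r`. -/
theorem sum_range_exp_eq_zero_of_differentiableAt {r : ℝ} (hg : DifferentiableAt ℝ g r) {b : ℕ}
    (hb : 0 < b) {c : ℕ → ℂ}
    (hc : ∀ n : ℕ, c n = Complex.exp ((2 * Real.pi * (n : ℝ) ^ 2 * r : ℝ) * Complex.I))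
    (hper : ∀ m j, c (b * m + j) = c j) : ∑ j ∈ Finset.range b, c j = 0 := by
  let B : ContDiffBump (3 : ℝ) := ⟨2, 5 / 2, by norm_num, by norm_num⟩
  have hB1 (x : ℝ) (h1 : 1 ≤ x) (h2 : x ≤ 4) : B x = 1 := by
    refine B.one_of_mem_closedBall ?_
    rw [Metric.mem_closedBall, Real.dist_eq, abs_le]
    constructor <;> simp only [B] <;> linarith
  have hB0 (x : ℝ) (h : x ≤ 0 ∨ 9 ≤ x) : B x = 0 := by
    refine B.zero_of_le_dist ?_
    rw [Real.dist_eq, le_abs]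
    simp only [B]
    rcases h with h | h
    · right; linarith
    · left; linarith
  let Ψ : 𝓢(ℝ, ℂ) := HasCompactSupport.toSchwartzMap (f := fun ξ : ℝ ↦ (ξ : ℂ) * ((B ξ : ℝ) : ℂ))
    (B.hasCompactSupport.comp_left (g := ((↑) : ℝ → ℂ)) Complex.ofReal_zero).mul_left
    (Complex.ofRealCLM.contDiff.mul (Complex.ofRealCLM.contDiff.comp B.contDiff))
  have hΨ (ξ : ℝ) : Ψ ξ = (ξ : ℂ) * (B ξ : ℝ) := rfl
  have hΨ0 : ∀ ξ ≤ 0, Ψ ξ = 0 := fun ξ h ↦ by simp [hΨ, hB0 ξ (.inl h)]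
  have hsupp : HasCompactSupport fun y : ℝ ↦ B (y ^ 2) := by
    refine HasCompactSupport.intro (K := Set.Icc (-3) 3) isCompact_Icc fun y hy ↦ hB0 _ (.inr ?_)
    by_contra! h
    exact hy (abs_le.1 (abs_le_of_sq_le_sq (by linarith) (by norm_num)))
  obtain ⟨L, hL⟩ := ContDiff.lipschitzWith_of_hasCompactSupport (𝕂 := ℝ) (n := 1) hsupp
    (B.contDiff.comp (contDiff_id.pow 2)) one_ne_zero
  obtain ⟨C, hC⟩ := exists_norm_tsum_le_of_differentiableAt Ψ hΨ0 hg
  have hc1 (n : ℕ) : ‖c n‖ ≤ 1 := by rw [hc, Complex.norm_exp_ofReal_mul_I]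
  have hb' : (0 : ℝ) < b := by exact_mod_cast hb
  have hbound (N : ℕ) (hN : 0 < N) : N * ‖∑ j ∈ Finset.range b, c j‖ ≤ C + 3 * b * L := by
    have hN' : (0 : ℝ) < N := by exact_mod_cast hN
    have hlow := le_norm_sum_periodic_mul hb hper hc1 hL (fun x ↦ B.nonneg)
      (fun x h1 h2 ↦ hB1 _ (by nlinarith) (by nlinarith)) hN
    have hup := hC (1 / (b * N) ^ 2) (by positivity)
    have hterm (n : ℕ) : Complex.exp ((2 * Real.pi * (n : ℝ) ^ 2 * r : ℝ) * Complex.I) *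
        (Ψ ((n : ℝ) ^ 2 * (1 / (b * N) ^ 2)) / (n : ℂ) ^ 2) =
        ((1 / (b * N) ^ 2 : ℝ) : ℂ) * (c n * (B (((n : ℝ) / (b * N)) ^ 2) : ℝ)) := by
      rw [← hc, hΨ, show (n : ℝ) ^ 2 * (1 / (b * N) ^ 2) = ((n : ℝ) / (b * N)) ^ 2 by ring]
      rcases eq_or_ne n 0 with rfl | hn
      · simp [hB0 0 (.inl le_rfl)]
      · have : (n : ℂ) ≠ 0 := by exact_mod_cast hn
        push_cast
        field_simp
    simp_rw [hterm] at hup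
    rw [tsum_mul_left, norm_mul, Complex.norm_real, Real.norm_of_nonneg (by positivity),
      mul_comm C, mul_le_mul_iff_right₀ (by positivity),
      tsum_eq_sum (s := Finset.range (b * (3 * N))) fun n hn ↦ ?_] at hup
    · linarith
    · have : (3 : ℝ) ≤ n / (b * N) := by
        rw [le_div_iff₀ (by positivity)]
        have : b * (3 * N) ≤ n := by simpa using hn
        have : (b : ℝ) * (3 * N) ≤ n := by exact_mod_cast this
        linarith
      rw [hB0 _ (.inr (by nlinarith))]
      simp
  by_contra hne
  have hpos := norm_pos_iff.2 hne
  obtain ⟨N, hN⟩ := exists_nat_gt ((C + 3 * b * L) / ‖∑ j ∈ Finset.range b, c j‖)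
  rw [div_lt_iff₀ hpos] at hN
  have := hbound (N + 1) N.succ_pos
  push_cast at this
  linarith

end

/-- A quadratic Gauss sum over `ZMod b` does not vanish when `b ≢ 2 (mod 4)`. -/
theorem quadratic_gauss_sum_ne_zero (b : ℕ) [NeZero b] (hb : b % 4 ≠ 2) (a : ZMod b)
    (ha : IsUnit a) : ∑ x : ZMod b, ZMod.stdAddChar (a * x ^ 2) ≠ 0 := by
  intro h0
  have h1 : (∑ y : ZMod b, ZMod.stdAddChar (-(a * y ^ 2))) *
      (∑ x : ZMod b, ZMod.stdAddChar (a * x ^ 2)) =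
      ∑ d : ZMod b, (ZMod.stdAddChar (a * d ^ 2) : ℂ) *
        ∑ y : ZMod b, ZMod.stdAddChar (y * (2 * a * d)) := by
    calc _ = ∑ y : ZMod b, ∑ d : ZMod b, (ZMod.stdAddChar (-(a * y ^ 2)) : ℂ) *
          ZMod.stdAddChar (a * (d + y) ^ 2) := by
          rw [Finset.sum_mul]
          refine Finset.sum_congr rfl fun y _ ↦ ?_
          rw [Finset.mul_sum]
          exact (Equiv.sum_comp (Equiv.addRight y)
            (fun x ↦ (ZMod.stdAddChar (-(a * y ^ 2)) : ℂ) * ZMod.stdAddChar (a * x ^ 2))).symm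
      _ = _ := by
          rw [Finset.sum_comm]
          refine Finset.sum_congr rfl fun d _ ↦ ?_
          rw [Finset.mul_sum]
          refine Finset.sum_congr rfl fun y _ ↦ ?_
          rw [← AddChar.map_add_eq_mul, ← AddChar.map_add_eq_mul]
          congr 1
          ring
  rw [h0, mul_zero] at h1
  have hterm : ∀ d : ZMod b, (ZMod.stdAddChar (a * d ^ 2) : ℂ) *
        ∑ y : ZMod b, ZMod.stdAddChar (y * (2 * a * d)) = if 2 * d = 0 then (b : ℂ) else 0 := by
    intro d
    rw [AddChar.sum_mulShift _ (ZMod.isPrimitive_stdAddChar b), ZMod.card]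
    have hiff : 2 * a * d = 0 ↔ 2 * d = 0 := by
      rw [show 2 * a * d = a * (2 * d) by ring, ha.mul_right_eq_zero]
    by_cases hd : 2 * d = 0
    · rw [if_pos (hiff.2 hd), if_pos hd]
      have : d ^ 2 = 0 := by
        obtain ⟨k, rfl⟩ := ZMod.natCast_zmod_surjective d
        have hk : b ∣ 2 * k := by
          rw [← ZMod.natCast_eq_zero_iff]; exact_mod_cast hd
        have : b ∣ k ^ 2 := by
          rcases Nat.even_or_odd b with he | ho
          · obtain ⟨c, hc⟩ : 4 ∣ b := by
              obtain ⟨c, hc⟩ := he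
              omega
            obtain ⟨e, he⟩ := hk
            have hke : k = 2 * c * e := by
              rw [hc] at he
              linarith
            rw [hke, hc]
            exact ⟨c * e ^ 2, by ring⟩
          · have : b ∣ k := (Nat.coprime_two_right.2 ho).dvd_of_dvd_mul_left hk
            exact this.trans (dvd_pow_self _ two_ne_zero)
        exact_mod_cast (ZMod.natCast_eq_zero_iff _ _).2 this
      rw [this, mul_zero, AddChar.map_zero_eq_one, one_mul]
    · rw [if_neg (hiff.not.2 hd), if_neg hd]; simp
  rw [Finset.sum_congr rfl fun d _ ↦ hterm d, Finset.sum_ite, Finset.sum_const_zero, add_zero,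
    Finset.sum_const, nsmul_eq_mul] at h1
  have hb0 : (b : ℂ) ≠ 0 := by exact_mod_cast NeZero.ne b
  have hcard := (mul_eq_zero.1 h1.symm).resolve_right hb0
  have hempty : (Finset.univ.filter fun d : ZMod b ↦ 2 * d = 0) = ∅ := by
    rw [← Finset.card_eq_zero]; exact_mod_cast hcard
  have : (0 : ZMod b) ∈ (Finset.univ.filter fun d : ZMod b ↦ 2 * d = 0) := by simp
  rw [hempty] at this
  simp at this

/-- At a rational `r = a/b` in lowest terms (with `b > 0`) whose denominator is not
congruent to 2 mod 4 — equivalently, `r` is not of the form `p/(2q)` with `p, q`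
odd — Riemann's function is not differentiable. -/
theorem stmt_10 (r : ℚ) (hr : r.den % 4 ≠ 2) :
    ¬ DifferentiableAt ℝ g (r : ℝ) := by
  intro hg
  have : NeZero r.den := ⟨r.den_nz⟩
  have ha : IsUnit (r.num : ZMod r.den) := by
    rw [ZMod.coe_int_isUnit_iff_isCoprime, Int.isCoprime_iff_gcd_eq_one, Int.gcd_comm]
    exact r.reduced
  let c (n : ℕ) : ℂ := ZMod.stdAddChar ((r.num : ZMod r.den) * (n : ZMod r.den) ^ 2)
  have hc (n : ℕ) :
      c n = Complex.exp ((2 * Real.pi * (n : ℝ) ^ 2 * r : ℝ) * Complex.I) := by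
    have := ZMod.stdAddChar_coe (N := r.den) (r.num * (n : ℤ) ^ 2)
    push_cast at this
    simp only [c]
    rw [this]
    congr 1
    rw [Rat.cast_def r]
    push_cast
    ring
  refine quadratic_gauss_sum_ne_zero r.den hr r.num ha ?_
  rw [← sum_range_exp_eq_zero_of_differentiableAt hg r.pos hc (fun m j ↦ by simp [c])]
  refine Finset.sum_nbij' (fun x ↦ x.val) (fun n ↦ (n : ZMod r.den)) ?_ ?_ ?_ ?_ ?_
  · exact fun x _ ↦ Finset.mem_range.2 x.val_lt
  · simp
  · simp
  · exact fun n hn ↦ ZMod.val_cast_of_lt (Finset.mem_range.1 hn)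
  · simp [c]
end

section
/- Let χ : ℤ → ℤ be defined by χ(n) = 1 if n ≡ 1 or 11 (mod 12), χ(n) = −1 if n ≡ 5 or 7 (mod 12), and χ(n) = 0 otherwise. The function h : ℝ → ℂ defined by h(x) = ∑_{n=1}^∞ χ(n) n^{−2} e(n²x/24) is Hölder continuous of index 3/4: there exists C > 0 such that |h(x) − h(y)| ≤ C|x − y|^{3/4} for all x, y ∈ ℝ. -/
open Complex Filter

/-- The even primitive Dirichlet character modulo 12 (the Kronecker symbol `(12/·)`). -/
def χ (n : ℤ) : ℤ :=
  if n % 12 = 1 ∨ n % 12 = 11 then 1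
  else if n % 12 = 5 ∨ n % 12 = 7 then -1
  else 0

/-- The (normalized) antiderivative of the boundary distribution of the Dedekind
eta function: `h(x) = ∑_{n ≥ 1} χ(n) n⁻² e(n²x/24)`.
(The `n = 0` term of the `tsum` vanishes, since `χ 0 = 0`.) -/
noncomputable def h (x : ℝ) : ℂ :=
  ∑' n : ℕ, (χ (n : ℤ) : ℂ) / (n : ℂ) ^ 2 * e ((n : ℝ) ^ 2 * x / 24)

open Finset in
/-- The finite products `∏ (1 - x ^ (k + i + 1))` are bounded uniformly in the shift and length. -/
lemma norm_prod_one_sub_pow_le {x : ℂ} (hx : ‖x‖ < 1) (k n : ℕ) :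
    ‖∏ i ∈ range n, (1 - x ^ (k + i + 1))‖ ≤ Real.exp (1 - ‖x‖)⁻¹ := by
  have hgeom := hasSum_geometric_of_lt_one (norm_nonneg x) hx
  calc ‖∏ i ∈ range n, (1 - x ^ (k + i + 1))‖
      ≤ ∏ i ∈ range n, (1 + ‖x‖ ^ i) := by
        rw [norm_prod]
        refine prod_le_prod (fun _ _ ↦ norm_nonneg _) fun i _ ↦ ?_
        grw [norm_sub_le, norm_one, norm_pow]
        gcongr 1 + ?_
        exact pow_le_pow_of_le_one (norm_nonneg x) hx.le (by lia)
    _ ≤ Real.exp (∑ i ∈ range n, ‖x‖ ^ i) :=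
        Real.prod_one_add_le_exp_sum _ fun _ ↦ by positivity
    _ ≤ Real.exp (1 - ‖x‖)⁻¹ :=
        Real.exp_le_exp.mpr (sum_le_hasSum _ (fun _ _ ↦ by positivity) hgeom)

/-- **Pentagonal number theorem** for complex numbers in the open unit disc. -/
theorem tprod_one_sub_pow_eq_tsum_pentagonal {x : ℂ} (hx : ‖x‖ < 1) :
    ∏' n : ℕ, (1 - x ^ (n + 1)) =
      ∑' k : ℕ, (-1) ^ k * (x ^ pentagonal (-k) - x ^ pentagonal (k + 1)) := by
  have hgeom := hasSum_geometric_of_lt_one (norm_nonneg x) hx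
  have hterm (k n : ℕ) :
      ‖x ^ ((k + 1) * n) * ∏ i ∈ Finset.range (n + 1), (1 - x ^ (k + i + 1))‖ ≤
        ‖x‖ ^ n * Real.exp (1 - ‖x‖)⁻¹ := by
    grw [norm_mul, norm_pow, norm_prod_one_sub_pow_le hx]
    gcongr ?_ * _
    exact pow_le_pow_of_le_one (norm_nonneg x) hx.le (by nlinarith)
  have hgeom' := hgeom.mul_right (Real.exp (1 - ‖x‖)⁻¹)
  have hpow (k m : ℕ) (hkm : k ≤ m) : ‖x ^ m‖ ≤ ‖x‖ ^ k := by
    rw [norm_pow]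
    exact pow_le_pow_of_le_one (norm_nonneg x) hx.le hkm
  have hpow_tendsto := tendsto_pow_atTop_nhds_zero_of_lt_one (norm_nonneg x) hx
  refine Pentagonal.tprod_one_sub_pow (tendsto_pow_atTop_nhds_zero_of_norm_lt_one hx)
    (fun k ↦ hgeom'.summable.of_norm_bounded (hterm k)) (fun k ↦ ?_) ?_ ?_
  · simp_rw [sub_eq_add_neg]
    refine multipliable_one_add_of_summable (hgeom.summable.of_nonneg_of_le
      (fun _ ↦ norm_nonneg _) fun n ↦ ?_)
    rw [norm_neg]
    exact hpow n _ (by lia)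
  · refine (hgeom.summable.mul_left 2).of_norm_bounded fun k ↦ ?_
    have h1 := hpow k (pentagonal (-k)) (by
      have := two_mul_natCast_pentagonal_neg k
      zify; nlinarith)
    have h2 := hpow k (pentagonal (k + 1)) (by
      have := two_mul_natCast_pentagonal (k + 1)
      zify; nlinarith)
    grw [norm_mul, norm_pow, norm_neg, norm_one, one_pow, one_mul, norm_sub_le, h1, h2]
    linarith
  · refine squeeze_zero_norm (fun k ↦ ?_)
      (by simpa using hpow_tendsto.mul_const ((1 - ‖x‖)⁻¹ * Real.exp (1 - ‖x‖)⁻¹))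
    have h1 := hpow k ((k + 1) * (3 * k + 4) / 2)
      ((Nat.le_div_iff_mul_le two_pos).mpr (by nlinarith))
    grw [norm_mul, norm_mul, norm_pow, norm_neg, norm_one, one_pow, one_mul, h1,
      tsum_of_norm_bounded hgeom' (hterm k)]

/-- The holomorphic extension of `h` to the upper half plane. -/
noncomputable def etaPrimitive (z : ℂ) : ℂ :=
  ∑' n : ℕ, (χ (n : ℤ) : ℂ) / (n : ℂ) ^ 2 * cexp (2 * Real.pi * I * ((n : ℂ) ^ 2 * z / 24))

lemma h_eq_etaPrimitive (x : ℝ) : h x = etaPrimitive x := by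
  simp [h, e, etaPrimitive]

lemma norm_χ_le_one (n : ℤ) : ‖(χ n : ℂ)‖ ≤ 1 := by
  unfold χ
  split_ifs <;> simp

lemma norm_etaPrimitive_term_le (n : ℕ) {z : ℂ} (hz : 0 ≤ z.im) :
    ‖(χ (n : ℤ) : ℂ) / (n : ℂ) ^ 2 * cexp (2 * Real.pi * I * ((n : ℂ) ^ 2 * z / 24))‖ ≤
      1 / (n : ℝ) ^ 2 := by
  have hexp : ‖cexp (2 * Real.pi * I * ((n : ℂ) ^ 2 * z / 24))‖ ≤ 1 := by
    rw [show 2 * Real.pi * I * ((n : ℂ) ^ 2 * z / 24) =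
      ((Real.pi * n ^ 2 / 12 : ℝ) : ℂ) * (I * z) by push_cast; ring, norm_exp, re_ofReal_mul]
    have : 0 ≤ Real.pi * n ^ 2 / 12 * z.im := by positivity
    simpa using this
  grw [norm_mul, norm_div, norm_χ_le_one, hexp]
  simp

lemma continuousOn_etaPrimitive : ContinuousOn etaPrimitive {z | 0 ≤ z.im} :=
  continuousOn_tsum (fun _ ↦ by fun_prop) (Real.summable_one_div_nat_pow.mpr one_lt_two)
    fun n _ hz ↦ norm_etaPrimitive_term_le n hz

lemma hasDerivAt_etaPrimitive_term (n : ℕ) (z : ℂ) :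
    HasDerivAt (fun z ↦
        (χ (n : ℤ) : ℂ) / (n : ℂ) ^ 2 * cexp (2 * Real.pi * I * ((n : ℂ) ^ 2 * z / 24)))
      (Real.pi * I / 12 *
        ((χ (n : ℤ) : ℂ) * cexp (2 * Real.pi * I * ((n : ℂ) ^ 2 * z / 24)))) z := by
  have hlin : HasDerivAt (fun z : ℂ ↦ 2 * Real.pi * I * ((n : ℂ) ^ 2 * z / 24))
      (2 * Real.pi * I * ((n : ℂ) ^ 2 * 1 / 24)) z :=
    (((hasDerivAt_id z).const_mul _).div_const _).const_mul _
  refine (hlin.cexp.const_mul _).congr_deriv ?_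
  rcases eq_or_ne n 0 with rfl | hn
  · simp [χ]
  · field_simp
    ring

/-- The pentagonal number theorem in terms of `χ`. -/
lemma eta_eq_tsum {z : ℂ} (hz : 0 < z.im)
    (hsum : Summable fun n : ℕ ↦
      (χ (n : ℤ) : ℂ) * cexp (2 * Real.pi * I * ((n : ℂ) ^ 2 * z / 24))) :
    ModularForm.eta z =
      ∑' n : ℕ, (χ (n : ℤ) : ℂ) * cexp (2 * Real.pi * I * ((n : ℂ) ^ 2 * z / 24)) := by
  have hq : ‖Function.Periodic.qParam 1 z‖ < 1 := by
    rw [Function.Periodic.norm_qParam, Real.exp_lt_one_iff]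
    have : 0 < Real.pi * z.im := by positivity
    linarith
  have hχ (k : ℕ) : χ ((1 + 6 * k : ℕ) : ℤ) = (-1) ^ k ∧ χ ((5 + 6 * k : ℕ) : ℤ) = -(-1) ^ k := by
    rcases Nat.even_or_odd' k with ⟨m, rfl | rfl⟩
    · rw [χ, χ, if_pos (by lia), if_neg (by lia), if_pos (by lia)]
      simp
    · rw [χ, χ, if_neg (by lia), if_pos (by lia), if_pos (by lia)]
      simp [pow_succ]
  have hexp (n p : ℕ) (hnp : n ^ 2 = 24 * p + 1) :
      cexp (2 * Real.pi * I * ((n : ℂ) ^ 2 * z / 24)) =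
        Function.Periodic.qParam 24 z * Function.Periodic.qParam 1 z ^ p := by
    rw [Function.Periodic.qParam, Function.Periodic.qParam, ← exp_nat_mul, ← exp_add]
    have : (n : ℂ) ^ 2 = 24 * p + 1 := mod_cast hnp
    rw [this]
    congr 1
    push_cast
    ring
  have hres (j : ℕ) : Summable fun m : ℕ ↦ (χ ((j + 6 * m : ℕ) : ℤ) : ℂ) *
      cexp (2 * Real.pi * I * (((j + 6 * m : ℕ) : ℂ) ^ 2 * z / 24)) :=
    hsum.comp_injective (i := fun m ↦ j + 6 * m) fun a b hab ↦ by simpa using hab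
  have hzero (j m : ℕ) (hj : j % 6 ≠ 1 ∧ j % 6 ≠ 5) : χ ((j + 6 * m : ℕ) : ℤ) = 0 := by
    rw [χ, if_neg (by lia), if_neg (by lia)]
  rw [Nat.sumByResidueClasses hsum 6]
  refine Eq.trans ?_ (Finset.sum_range (n := 6) fun j ↦ ∑' m : ℕ,
    (χ ((j + 6 * m : ℕ) : ℤ) : ℂ) * cexp (2 * Real.pi * I * (((j + 6 * m : ℕ) : ℂ) ^ 2 * z / 24)))
  simp only [Finset.sum_range_succ, Finset.sum_range_zero, hzero 0 _ (by decide),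
    hzero 2 _ (by decide), hzero 3 _ (by decide), hzero 4 _ (by decide), Int.cast_zero, zero_mul,
    tsum_zero, add_zero]
  rw [zero_add, ← (hres 1).tsum_add (hres 5), ModularForm.eta,
    tprod_one_sub_pow_eq_tsum_pentagonal hq, ← tsum_mul_left]
  refine tsum_congr fun k ↦ ?_
  rw [hexp (1 + 6 * k) (pentagonal (-k)) (by
      have := two_mul_natCast_pentagonal_neg k
      zify; linear_combination (-12) * this),
    hexp (5 + 6 * k) (pentagonal (k + 1)) (by
      have := two_mul_natCast_pentagonal (k + 1)
      zify; linear_combination (-12) * this), (hχ k).1, (hχ k).2]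
  push_cast
  ring

lemma hasDerivAt_etaPrimitive {z : ℂ} (hz : 0 < z.im) :
    HasDerivAt etaPrimitive (Real.pi * I / 12 * ModularForm.eta z) z := by
  have hopen : IsOpen {w : ℂ | 0 < w.im} := isOpen_lt continuous_const continuous_im
  have hu := Real.summable_one_div_nat_pow.mpr one_lt_two
  have hdiff (n : ℕ) : DifferentiableOn ℂ (fun z : ℂ ↦
      (χ (n : ℤ) : ℂ) / (n : ℂ) ^ 2 * cexp (2 * Real.pi * I * ((n : ℂ) ^ 2 * z / 24)))
      {w | 0 < w.im} := fun w _ ↦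
    (hasDerivAt_etaPrimitive_term n w).differentiableAt.differentiableWithinAt
  have hle (n : ℕ) (w : ℂ) (hw : w ∈ {w : ℂ | 0 < w.im}) :=
    norm_etaPrimitive_term_le n (le_of_lt (show 0 < w.im from hw))
  have hderiv := hasSum_deriv_of_summable_norm hu hdiff hopen hle hz
  simp_rw [(hasDerivAt_etaPrimitive_term _ _).deriv] at hderiv
  have hpi : (Real.pi * I / 12 : ℂ) ≠ 0 := by simp [Real.pi_ne_zero]
  rw [eta_eq_tsum hz ((summable_mul_left_iff hpi).mp hderiv.summable), ← tsum_mul_left,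
    hderiv.tsum_eq]
  exact ((differentiableOn_tsum_of_summable_norm hu hdiff hopen hle).differentiableAt
    (hopen.mem_nhds hz)).hasDerivAt

/-- The Dedekind eta function, being a cusp form of weight `1/2`, is `O(y ^ (-1/4))`. -/
lemma exists_norm_eta_le :
    ∃ C > 0, ∀ z : ℂ, 0 < z.im → ‖ModularForm.eta z‖ ≤ C * z.im ^ (-(1 / 4) : ℝ) := by
  obtain ⟨C, hC⟩ := CuspFormClass.exists_bound CuspForm.discriminant
  refine ⟨(max C 1) ^ (1 / 24 : ℝ), by positivity, fun z hz ↦ ?_⟩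
  have hΔ := hC ⟨z, hz⟩
  rw [CuspForm.coe_discriminant, ModularForm.discriminant, norm_pow] at hΔ
  refine le_of_pow_le_pow_left₀ (n := 24) (by norm_num) (by positivity) (hΔ.trans ?_)
  rw [mul_pow, ← Real.rpow_mul_natCast (by positivity), ← Real.rpow_mul_natCast hz.le,
    div_eq_mul_inv, ← Real.rpow_neg (UpperHalfPlane.im_pos _).le]
  norm_num
  gcongr
  exact le_max_left _ _

/-- `x ↦ F x` for real `x` is Hölder continuous of index `1 - s` when `F` is continuous on the
closed upper half plane and holomorphic inside with derivative `O(y ^ (-s))`, `0 ≤ s < 1`. -/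
lemma norm_sub_le_of_hasDerivAt_of_norm_le_rpow {F F' : ℂ → ℂ} {C s : ℝ} (hC : 0 ≤ C)
    (hs0 : 0 ≤ s) (hs1 : s < 1) (hF : ContinuousOn F {z | 0 ≤ z.im})
    (hF' : ∀ z : ℂ, 0 < z.im → HasDerivAt F (F' z) z)
    (hbound : ∀ z : ℂ, 0 < z.im → ‖F' z‖ ≤ C * z.im ^ (-s)) (x y : ℝ) :
    ‖F x - F y‖ ≤ C * (2 / (1 - s) + 1) * |x - y| ^ (1 - s) := by
  rcases eq_or_ne x y with rfl | hxy
  · simp [Real.zero_rpow (sub_pos.mpr hs1).ne']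
  set δ := |x - y| with hδ_def
  have hδ : 0 < δ := abs_pos.mpr (sub_ne_zero.mpr hxy)
  have hs : 0 < 1 - s := sub_pos.mpr hs1
  have hvert (u : ℝ) : ‖F u - F (u + δ * I)‖ ≤ C / (1 - s) * δ ^ (1 - s) := by
    have hpath (t : ℝ) : ((u : ℂ) + (δ - t) * I).im = δ - t := by simp
    have hB : Continuous fun t : ℝ ↦ C / (1 - s) * (δ ^ (1 - s) - (δ - t) ^ (1 - s)) := by
      have : Continuous fun t : ℝ ↦ (δ - t) ^ (1 - s) :=
        (by fun_prop : Continuous fun t : ℝ ↦ δ - t).rpow_const fun _ ↦ .inr hs.le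
      fun_prop
    have key := image_norm_le_of_norm_deriv_right_le_deriv_boundary' (a := 0) (b := δ)
      (f := fun t : ℝ ↦ F (u + (δ - t) * I) - F (u + δ * I))
      (f' := fun t : ℝ ↦ F' (u + (δ - t) * I) * (-1 * I))
      (B := fun t ↦ C / (1 - s) * (δ ^ (1 - s) - (δ - t) ^ (1 - s)))
      (B' := fun t ↦ C * (δ - t) ^ (-s)) ?_ ?_ (by simp) hB.continuousOn ?_ ?_
      (Set.right_mem_Icc.mpr hδ.le)
    · simpa [Real.zero_rpow hs.ne'] using key
    · refine ContinuousOn.sub (hF.comp (by fun_prop) fun t ht ↦ ?_) continuousOn_const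
      simpa [hpath] using ht.2
    · intro t ht
      have him : 0 < ((u : ℂ) + (δ - t) * I).im := by simpa [hpath] using ht.2
      have hlin : HasDerivAt (fun t : ℝ ↦ (u : ℂ) + (δ - t) * I) (-1 * I) t :=
        (((hasDerivAt_id t).ofReal_comp.const_sub (δ : ℂ)).mul_const I).const_add (u : ℂ)
      exact (((hF' _ him).comp t hlin).sub_const _).hasDerivWithinAt
    · intro t ht
      have hpos : 0 < δ - t := sub_pos.mpr ht.2
      refine (((((hasDerivAt_id t).const_sub δ).rpow_const (p := 1 - s)
        (.inl hpos.ne')).const_sub (δ ^ (1 - s))).const_mul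
        (C / (1 - s))).hasDerivWithinAt.congr_deriv ?_
      simp only [id, show 1 - s - 1 = -s by ring]
      field_simp
    · intro t ht
      have him : 0 < ((u : ℂ) + (δ - t) * I).im := by simpa [hpath] using ht.2
      simpa [hpath] using hbound _ him
  have hhor : ‖F (x + δ * I) - F (y + δ * I)‖ ≤ C * δ ^ (1 - s) := by
    have hmem (u : ℝ) : (u + δ * I : ℂ) ∈ {z : ℂ | δ ≤ z.im} := by simp
    have key := (convex_halfSpace_im_ge δ).norm_image_sub_le_of_norm_hasDerivWithin_le
      (f := F) (f' := F') (C := C * δ ^ (-s)) (x := y + δ * I) (y := x + δ * I)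
      (fun z hz ↦ (hF' z (hδ.trans_le hz)).hasDerivWithinAt)
      (fun z hz ↦ (hbound z (hδ.trans_le hz)).trans (mul_le_mul_of_nonneg_left
        (Real.rpow_le_rpow_of_nonpos hδ hz (neg_nonpos.mpr hs0)) hC)) (hmem y) (hmem x)
    rwa [add_sub_add_right_eq_sub, ← ofReal_sub, norm_real, Real.norm_eq_abs, ← hδ_def, mul_assoc,
      ← Real.rpow_add_one hδ.ne', neg_add_eq_sub] at key
  calc ‖F x - F y‖ = ‖(F x - F (x + δ * I)) + (F (x + δ * I) - F (y + δ * I)) -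
        (F y - F (y + δ * I))‖ := by congr 1; ring
    _ ≤ C / (1 - s) * δ ^ (1 - s) + C * δ ^ (1 - s) + C / (1 - s) * δ ^ (1 - s) := by
      grw [norm_sub_le, norm_add_le, hvert x, hvert y, hhor]
    _ = _ := by ring

/-- `h` is Hölder continuous of index 3/4. -/
theorem stmt_12 :
    ∃ C > (0:ℝ), ∀ x y : ℝ, ‖h x - h y‖ ≤ C * |x - y| ^ ((3:ℝ)/4) := by
  obtain ⟨C, hC, hη⟩ := exists_norm_eta_le
  refine ⟨Real.pi / 12 * C * (2 / (1 - 1 / 4) + 1), by positivity, fun x y ↦ ?_⟩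
  have hbound (z : ℂ) (hz : 0 < z.im) :
      ‖Real.pi * I / 12 * ModularForm.eta z‖ ≤ Real.pi / 12 * C * z.im ^ (-(1 / 4) : ℝ) := by
    grw [norm_mul, hη z hz, ← mul_assoc]
    simp [abs_of_pos Real.pi_pos]
  have key := norm_sub_le_of_hasDerivAt_of_norm_le_rpow (by positivity) (by norm_num)
    (by norm_num) continuousOn_etaPrimitive (fun z hz ↦ hasDerivAt_etaPrimitive hz) hbound x y
  rw [h_eq_etaPrimitive, h_eq_etaPrimitive]
  convert key using 3
  norm_num
end
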